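/- For every integer d ≥ 2 and every mass distribution μ on ℝ^d, there exist a unit vector u ∈ ℝ^d, real numbers t_1 < t_2 < ... < t_{2d-3}, a unit vector v with v ≠ u and v ≠ -u, and a real number s, such that each of the 2(2d-2) = 4d-4 regions of the form {x : t_i < ⟨x,u⟩ < t_{i+1}} ∩ {x : ⟨x,v⟩ < s} and {x : t_i < ⟨x,u⟩ < t_{i+1}} ∩ {x : ⟨x,v⟩ > s} (for 0 ≤ i ≤ 2d-3, with t_0 = -∞ and t_{2d-2} = +∞) has μ-measure μ(ℝ^d)/(4d-4). That is, every mass distribution in ℝ^d admits an equipartition into 4d-4 boxes by a collection of 2d-3 parallel hyperplanes and one additional non-parallel hyperplane. -/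

import Mathlib

open MeasureTheory

/-- The open slab between consecutive parallel hyperplanes orthogonal to `u`:
for `0 ≤ i ≤ n`, the region `{x : t i < ⟪x,u⟫ < t (i+1)}`, with the conventions
`t 0 = -∞` and `t (n+1) = +∞` (i.e. the corresponding inequality is dropped). -/
noncomputable def slab {d : ℕ} (u : EuclideanSpace ℝ (Fin d)) (t : ℕ → ℝ) (n i : ℕ) :
    Set (EuclideanSpace ℝ (Fin d)) :=
  {x | (1 ≤ i → t i < (inner ℝ x u : ℝ)) ∧ (i + 1 ≤ n → (inner ℝ x u : ℝ) < t (i + 1))}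

/-- The open halfspace below (`b = true`) or above (`b = false`) the hyperplane
orthogonal to `v` at level `s`. -/
def halfSp {d : ℕ} (v : EuclideanSpace ℝ (Fin d)) (s : ℝ) (b : Bool) :
    Set (EuclideanSpace ℝ (Fin d)) :=
  if b then {x | (inner ℝ x v : ℝ) < s} else {x | s < (inner ℝ x v : ℝ)}



namespace Equi

/-- The finite set of flags of the cubical grid: top cell `q`, order `π`, signs `ε`. -/
noncomputable def Fl (n : ℕ) (M : ℤ) :
    Finset ((Fin n → ℤ) × Equiv.Perm (Fin n) × (Fin n → ℤˣ)) :=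
  (Fintype.piFinset (fun _ : Fin n => (Finset.Icc (-M) M).filter Odd)) ×ˢ
    ((Finset.univ : Finset (Equiv.Perm (Fin n))) ×ˢ (Finset.univ : Finset (Fin n → ℤˣ)))

/-- The `l`-th vertex of a flag. -/
def pt {n : ℕ} (x : (Fin n → ℤ) × Equiv.Perm (Fin n) × (Fin n → ℤˣ)) (l : ℕ) : Fin n → ℤ :=
  fun i => if l ≤ ((x.2.1 i : Fin n) : ℕ) then x.1 i + (x.2.2 i : ℤ) else x.1 i

lemma mem_Fl {n : ℕ} {M : ℤ} {x : (Fin n → ℤ) × Equiv.Perm (Fin n) × (Fin n → ℤˣ)} :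
    x ∈ Fl n M ↔ ∀ i, (-M ≤ x.1 i ∧ x.1 i ≤ M) ∧ Odd (x.1 i) := by
  simp [Fl, Fintype.mem_piFinset]

lemma unit_cases (e : ℤˣ) : (e : ℤ) = 1 ∨ (e : ℤ) = -1 := by
  rcases Int.units_eq_one_or e with h | h <;> simp [h]

lemma pt_box {n : ℕ} {M : ℤ} (hM : Even M)
    {x : (Fin n → ℤ) × Equiv.Perm (Fin n) × (Fin n → ℤˣ)} (hx : x ∈ Fl n M) (l : ℕ) (i : Fin n) :
    |pt x l i| ≤ M := by
  obtain ⟨⟨h1, h2⟩, k, hk⟩ := mem_Fl.1 hx i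
  obtain ⟨N, hN⟩ := hM
  rw [abs_le]
  unfold pt
  rcases unit_cases (x.2.2 i) with h | h <;> split_ifs <;> constructor <;> omega

lemma neg_unit_ne (e : ℤˣ) : -e ≠ e := by
  rcases Int.units_eq_one_or e with h | h <;> subst h <;> decide

lemma drop_mid {n : ℕ} {M : ℤ} (G : (ℕ → Fin n → ℤ) → ZMod 2) (k : ℕ) (hk : k < n)
    (hG : ∀ p p' : ℕ → Fin n → ℤ, (∀ l, l ≠ k → p l = p' l) → G p = G p') :
    ∑ x ∈ Fl n M, G (pt x) = 0 := by
  classical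
  rcases Nat.eq_zero_or_pos k with h0 | h0
  · subst h0
    refine Finset.sum_involution (fun x _ => (x.1, x.2.1,
      Function.update x.2.2 (x.2.1.symm ⟨0, hk⟩) (-(x.2.2 (x.2.1.symm ⟨0, hk⟩))))) ?_ ?_ ?_ ?_
    · intro x hx
      rw [CharTwo.add_eq_zero]
      apply hG
      intro l hl
      funext i
      unfold pt
      by_cases hi : i = x.2.1.symm ⟨0, hk⟩
      · subst hi
        simp [hl]
      · simp [Function.update_of_ne hi]
    · intro x hx _ h
      have := congrArg (fun y => y.2.2 (x.2.1.symm ⟨0, hk⟩)) h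
      simp only [Function.update_self] at this
      exact neg_unit_ne _ this
    · intro x hx
      rw [mem_Fl] at hx ⊢
      exact hx
    · intro x hx
      simp
  · have hk1 : k - 1 < n := by omega
    have hne : (⟨k - 1, hk1⟩ : Fin n) ≠ ⟨k, hk⟩ := by
      intro h
      have := congrArg Fin.val h
      simp at this
      omega
    refine Finset.sum_involution (fun x _ => (x.1,
      x.2.1.trans (Equiv.swap (⟨k - 1, hk1⟩ : Fin n) ⟨k, hk⟩), x.2.2)) ?_ ?_ ?_ ?_
    · intro x hx
      rw [CharTwo.add_eq_zero]
      apply hG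
      intro l hl
      funext i
      unfold pt
      simp only [Equiv.trans_apply]
      have : l ≤ ((Equiv.swap (⟨k - 1, hk1⟩ : Fin n) ⟨k, hk⟩ (x.2.1 i) : Fin n) : ℕ) ↔
          l ≤ ((x.2.1 i : Fin n) : ℕ) := by
        rw [Equiv.swap_apply_def]
        split_ifs with h1 h2
        · rw [h1]; simp; omega
        · rw [h2]; simp; omega
        · rfl
      simp only [this]
    · intro x hx _ h
      have := congrArg (fun y => y.2.1 (x.2.1.symm ⟨k, hk⟩)) h
      simp at this
      omega
    · intro x hx
      rw [mem_Fl] at hx ⊢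
      exact hx
    · intro x hx
      ext <;> simp

/-- Reflection of one block of coordinates. -/
def refl {n : ℕ} {R : Type*} [Neg R] (blk : Fin n → Bool) (β : Bool) (p : Fin n → R) : Fin n → R :=
  fun i => if blk i = β then - p i else p i

lemma drop_last {n : ℕ} {M : ℤ} (hM : Even M) (hn : 0 < n) (blk : Fin n → Bool)
    (G : (ℕ → Fin n → ℤ) → ZMod 2)
    (hG : ∀ p p' : ℕ → Fin n → ℤ, (∀ l, l < n → p l = p' l) → G p = G p')
    (hR : ∀ (p : ℕ → Fin n → ℤ) (β : Bool), (∀ l i, |p l i| ≤ M) →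
      (∃ i, blk i = β ∧ ∀ l < n, |p l i| = M) → G (fun l => refl blk β (p l)) = G p) :
    ∑ x ∈ Fl n M, G (pt x) = 0 := by
  classical
  have hl : n - 1 < n := by omega
  obtain ⟨N, hN⟩ := hM
  -- the last coordinate
  let ι : Equiv.Perm (Fin n) → Fin n := fun π => π.symm ⟨n - 1, hl⟩
  let mv : (Fin n → ℤ) × Equiv.Perm (Fin n) × (Fin n → ℤˣ) →
      (Fin n → ℤ) × Equiv.Perm (Fin n) × (Fin n → ℤˣ) := fun x =>
    (Function.update x.1 (ι x.2.1) (x.1 (ι x.2.1) + 2 * (x.2.2 (ι x.2.1) : ℤ)), x.2.1,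
      Function.update x.2.2 (ι x.2.1) (-(x.2.2 (ι x.2.1))))
  let rf : (Fin n → ℤ) × Equiv.Perm (Fin n) × (Fin n → ℤˣ) →
      (Fin n → ℤ) × Equiv.Perm (Fin n) × (Fin n → ℤˣ) := fun x =>
    (refl blk (blk (ι x.2.1)) x.1, x.2.1, refl blk (blk (ι x.2.1)) x.2.2)
  let g : (Fin n → ℤ) × Equiv.Perm (Fin n) × (Fin n → ℤˣ) →
      (Fin n → ℤ) × Equiv.Perm (Fin n) × (Fin n → ℤˣ) := fun x =>
    if |x.1 (ι x.2.1) + (x.2.2 (ι x.2.1) : ℤ)| = M then rf x else mv x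
  refine Finset.sum_involution (fun x _ => g x) ?_ ?_ ?_ ?_
  · intro x hx
    by_cases h : |x.1 (ι x.2.1) + (x.2.2 (ι x.2.1) : ℤ)| = M
    · have hg : g x = rf x := if_pos h
      have : pt (rf x) = fun l => refl blk (blk (ι x.2.1)) (pt x l) := by
        funext l i
        simp only [rf, pt, refl]
        split_ifs <;> simp <;> ring
      simp only [hg, this]
      rw [hR, CharTwo.add_self_eq_zero]
      · intro l i; exact pt_box ⟨N, hN⟩ hx l i
      · refine ⟨ι x.2.1, rfl, fun l hl' => ?_⟩
        rw [← h]
        unfold pt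
        rw [if_pos]
        simp [ι]; omega
    · have hg : g x = mv x := if_neg h
      simp only [hg]
      rw [hG (pt (mv x)) (pt x) _, CharTwo.add_self_eq_zero]
      intro l hl'
      funext i
      unfold pt
      simp only [mv]
      by_cases hi : i = ι x.2.1
      · have : l ≤ ((x.2.1 i : Fin n) : ℕ) := by
          rw [hi]; simp [ι]; omega
        rw [if_pos this, if_pos this]
        subst hi
        simp; ring
      · simp [Function.update_of_ne hi]
  · intro x hx _ h
    by_cases h' : |x.1 (ι x.2.1) + (x.2.2 (ι x.2.1) : ℤ)| = M
    · have hg : g x = rf x := if_pos h'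
      rw [hg] at h
      have := congrArg (fun y => y.2.2 (ι x.2.1)) h
      simp only [rf, refl, if_true] at this
      exact neg_unit_ne _ this
    · have hg : g x = mv x := if_neg h'
      rw [hg] at h
      have := congrArg (fun y => y.2.2 (ι x.2.1)) h
      simp only [mv, Function.update_self] at this
      exact neg_unit_ne _ this
  · intro x hx
    have hx' := hx
    rw [mem_Fl] at hx
    by_cases h' : |x.1 (ι x.2.1) + (x.2.2 (ι x.2.1) : ℤ)| = M
    · have hg : g x = rf x := if_pos h'
      rw [hg, mem_Fl]
      intro i
      obtain ⟨⟨h1, h2⟩, h3⟩ := hx i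
      simp only [rf, refl]
      split_ifs
      · exact ⟨⟨by omega, by omega⟩, h3.neg⟩
      · exact ⟨⟨h1, h2⟩, h3⟩
    · have hg : g x = mv x := if_neg h'
      rw [hg, mem_Fl]
      intro i
      obtain ⟨⟨h1, h2⟩, k, h3⟩ := hx i
      simp only [mv]
      by_cases hi : i = ι x.2.1
      · rw [← hi] at h' ⊢
        simp only [Function.update_self]
        have hne1 : x.1 i + (x.2.2 i : ℤ) ≠ M := by
          intro h; apply h'; rw [h]; apply abs_of_nonneg; omega
        have hne2 : x.1 i + (x.2.2 i : ℤ) ≠ -M := by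
          intro h; apply h'; rw [h, abs_neg]; apply abs_of_nonneg; omega
        rcases unit_cases (x.2.2 i) with h | h <;>
          refine ⟨⟨by omega, by omega⟩, ?_⟩
        · exact ⟨k + 1, by omega⟩
        · exact ⟨k - 1, by omega⟩
      · rw [Function.update_of_ne hi]
        exact ⟨⟨h1, h2⟩, k, h3⟩
  · intro x hx
    by_cases h' : |x.1 (ι x.2.1) + (x.2.2 (ι x.2.1) : ℤ)| = M
    · have hg : g x = rf x := if_pos h'
      have hg2 : g (rf x) = rf (rf x) := by
        apply if_pos
        rw [← h']
        simp only [rf, refl, if_true]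
        rw [← abs_neg]
        congr 1
        push_cast
        ring
      simp only [hg, hg2]
      ext i <;> simp [rf, refl] <;> split_ifs <;> simp
    · have hg : g x = mv x := if_neg h'
      have hg2 : g (mv x) = mv (mv x) := by
        apply if_neg
        intro h
        apply h'
        rw [← h]
        simp only [mv, Function.update_self]
        congr 1
        push_cast
        ring
      simp only [hg, hg2]
      ext i <;> simp [mv]

/-- Replacing one factor in a sum over flags. -/
lemma swap_factor {n : ℕ} {M : ℤ} (X X' : ℕ → (ℕ → Fin n → ℤ) → ZMod 2) (i : ℕ) (hi : i < n)
    (h : ∀ k, k ≠ i → X k = X' k)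
    (hr : ∀ p p' : ℕ → Fin n → ℤ, (∀ l, l ≠ i → p l = p' l) →
      X i p + X' i p = X i p' + X' i p')
    (hX : ∀ k, k < n → k ≠ i → ∀ p p' : ℕ → Fin n → ℤ, (∀ l, l ≠ i → p l = p' l) →
      X k p = X k p') :
    ∑ x ∈ Fl n M, ∏ k ∈ Finset.range n, X k (pt x) =
    ∑ x ∈ Fl n M, ∏ k ∈ Finset.range n, X' k (pt x) := by
  rw [← CharTwo.add_eq_zero, ← Finset.sum_add_distrib]
  have key : ∀ p, ∏ k ∈ Finset.range n, X k p + ∏ k ∈ Finset.range n, X' k p =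
      (X i p + X' i p) * ∏ k ∈ (Finset.range n).erase i, X k p := by
    intro p
    rw [← Finset.mul_prod_erase _ (fun k => X k p) (Finset.mem_range.2 hi),
      ← Finset.mul_prod_erase _ (fun k => X' k p) (Finset.mem_range.2 hi), add_mul]
    congr 2
    apply Finset.prod_congr rfl
    intro k hk
    rw [h k (Finset.ne_of_mem_erase hk)]
  simp only [key]
  refine drop_mid (fun p => (X i p + X' i p) * ∏ k ∈ (Finset.range n).erase i, X k p) i hi ?_
  intro p p' hp
  rw [hr p p' hp]
  congr 1
  apply Finset.prod_congr rfl
  intro k hk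
  exact hX k (Finset.mem_range.1 (Finset.mem_of_mem_erase hk)) (Finset.ne_of_mem_erase hk) _ _ hp

/-- A factor in one of three modes. -/
def fac {n : ℕ} (σ : ℕ → (Fin n → ℤ) → ZMod 2) (md : ℕ → ℕ) (k : ℕ) (p : ℕ → Fin n → ℤ) : ZMod 2 :=
  if md k = 0 then σ k (p k) else if md k = 1 then σ k (p k) + σ k (p (k + 1))
    else σ k (p k) + σ k (p (k - 1))

/-- The parity count. -/
noncomputable def cnt {n : ℕ} (M : ℤ) (σ : ℕ → (Fin n → ℤ) → ZMod 2) (md : ℕ → ℕ) : ZMod 2 :=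
  ∑ x ∈ Fl n M, ∏ k ∈ Finset.range n, fac σ md k (pt x)

lemma cnt_low {n : ℕ} (M : ℤ) (σ : ℕ → (Fin n → ℤ) → ZMod 2) (j : ℕ) (hj : j ≤ n) (i : ℕ)
    (hi : i ≤ j) :
    cnt M σ (fun k => if k < j then 1 else 0) =
      cnt M σ (fun k => if k < i then 0 else if k < j then 1 else 0) := by
  induction i with
  | zero => simp
  | succ i ih =>
    rw [ih (by omega)]
    unfold cnt
    apply swap_factor _ _ i (by omega)
    · intro k hk
      funext p
      unfold fac
      have : (k < i + 1) ↔ k < i := by omega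
      simp only [this]
    · intro p p' hp
      unfold fac
      have h1 := hp (i + 1) (by omega)
      have h2 : i < j := by omega
      simp only [lt_irrefl, if_false, h2, if_true, Nat.lt_succ_self, one_ne_zero]
      rw [h1, add_right_comm, CharTwo.add_self_eq_zero, add_right_comm, CharTwo.add_self_eq_zero]
    · intro k hk hki p p' hp
      have h1 := hp k hki
      unfold fac
      by_cases h : k < i
      · simp [h, h1]
      · have h2 := hp (k + 1) (by omega)
        by_cases h3 : k < j <;> simp [h, h1, h2, h3]

lemma cnt_high {n : ℕ} (M : ℤ) (σ : ℕ → (Fin n → ℤ) → ZMod 2) (j : ℕ) (J : ℕ)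
    (hj : j < J) (hJ : J ≤ n) :
    cnt M σ (fun k => if k < j then 1 else 0) =
      cnt M σ (fun k => if k < j then 1 else if k = j then 0 else if k < J then 2 else 0) := by
  induction J, hj using Nat.le_induction with
  | base =>
    congr 1
    funext k
    split_ifs <;> first | rfl | omega
  | succ J hJ' ih =>
    rw [ih (by omega)]
    unfold cnt
    apply swap_factor _ _ J (by omega)
    · intro k hk
      funext p
      unfold fac
      have : (k < J + 1) ↔ k < J := by omega
      simp only [this]
    · intro p p' hp
      unfold fac
      have h1 := hp (J - 1) (by omega)
      have h2 : ¬ J < j := by omega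
      have h3 : ¬ J = j := by omega
      simp only [h2, h3, lt_irrefl, if_false, if_true, Nat.lt_succ_self]
      simp only [OfNat.ofNat_ne_zero, OfNat.ofNat_ne_one, if_false]
      rw [h1, ← add_assoc, CharTwo.add_self_eq_zero, ← add_assoc, CharTwo.add_self_eq_zero]
    · intro k hk hki p p' hp
      have h1 := hp k hki
      unfold fac
      by_cases h : k < j
      · have h2 := hp (k + 1) (by omega)
        simp [h, h1, h2]
      · by_cases h3 : k = j
        · simp [h3] at h1 ⊢
          exact congrArg _ h1
        · by_cases h4 : k < J
          · have h2 := hp (k - 1) (by omega)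
            simp [h, h3, h4, h1, h2]
          · simp [h, h3, h4, h1]

/-- Equivariance of sign functions. -/
def Eqv {n : ℕ} (M : ℤ) (blk : Fin n → Bool) (χ : ℕ → Bool → ZMod 2)
    (σ : ℕ → (Fin n → ℤ) → ZMod 2) : Prop :=
  ∀ k < n, ∀ (p : Fin n → ℤ) (β : Bool), (∀ i, |p i| ≤ M) → (∃ i, blk i = β ∧ |p i| = M) →
    σ k (refl blk β p) = σ k p + χ k β

lemma cnt_zero {n : ℕ} {M : ℤ} (hM : Even M) (blk : Fin n → Bool) (χ : ℕ → Bool → ZMod 2)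
    (σ : ℕ → (Fin n → ℤ) → ZMod 2) (h : Eqv M blk χ σ) (j : ℕ) (hj : j < n)
    (hχ : ∀ β, χ j β = 0) : cnt M σ (fun _ => 1) = 0 := by
  have e1 : cnt M σ (fun _ => 1) = cnt M σ (fun k => if k < n then 1 else 0) := by
    unfold cnt
    apply Finset.sum_congr rfl; intro x _
    apply Finset.prod_congr rfl; intro k hk
    simp [fac, Finset.mem_range.1 hk]
  have e2 := cnt_low M σ n le_rfl n le_rfl
  have e3 := cnt_low M σ j hj.le j le_rfl
  have e4 : cnt M σ (fun k => if k < n then 0 else if k < n then 1 else 0) =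
      cnt M σ (fun k => if k < j then 0 else if k < j then 1 else 0) := by
    congr 1
    funext k
    split_ifs <;> rfl
  rw [e1, e2, e4, ← e3, cnt_high M σ j n hj le_rfl]
  unfold cnt
  apply drop_last hM (by omega) blk
    (fun p => ∏ k ∈ Finset.range n, fac σ
      (fun k => if k < j then 1 else if k = j then 0 else if k < n then 2 else 0) k p)
  · intro p p' hp
    apply Finset.prod_congr rfl; intro k hk
    have hk' := Finset.mem_range.1 hk
    unfold fac
    have h1 := hp k hk'
    by_cases h : k < j
    · have h2 := hp (k + 1) (by omega)
      simp [h, h1, h2]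
    · by_cases h3 : k = j
      · simp [h3] at h1 ⊢
        exact congrArg _ h1
      · have h2 := hp (k - 1) (by omega)
        simp [h, h3, h1, h2, hk']
  · intro p β hp ⟨i, hi, hpi⟩
    apply Finset.prod_congr rfl; intro k hk
    have hk' := Finset.mem_range.1 hk
    have e : ∀ l < n, σ k (refl blk β (p l)) = σ k (p l) + χ k β := fun l hl =>
      h k hk' (p l) β (hp l) ⟨i, hi, hpi l hl⟩
    have e' : ∀ a b c : ZMod 2, a + c + (b + c) = a + b := by decide
    unfold fac
    by_cases h : k < j
    · simp only [h, if_true, one_ne_zero, if_false]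
      rw [e k hk', e (k + 1) (by omega), e']
    · by_cases h3 : k = j
      · simp only [h, h3, lt_irrefl, if_true, if_false]
        rw [← h3, e k hk', h3, hχ, add_zero]
      · simp only [h, h3, hk', if_true, if_false, OfNat.ofNat_ne_zero, OfNat.ofNat_ne_one]
        rw [e k hk', e (k - 1) (by omega), e']

lemma cnt_indep {n : ℕ} {M : ℤ} (hM : Even M) (blk : Fin n → Bool) (χ : ℕ → Bool → ZMod 2)
    (σ σ' : ℕ → (Fin n → ℤ) → ZMod 2) (h : Eqv M blk χ σ) (h' : Eqv M blk χ σ') :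
    cnt M σ (fun _ => 1) = cnt M σ' (fun _ => 1) := by
  have main : ∀ j ≤ n, cnt M σ (fun _ => 1) =
      cnt M (fun k => if k < j then σ' k else σ k) (fun _ => 1) := by
    intro j
    induction j with
    | zero => simp
    | succ j ih =>
      intro hj
      rw [ih (by omega), ← CharTwo.add_eq_zero]
      have hz := cnt_zero hM blk (fun k β => if k = j then 0 else χ k β)
        (fun k => if k < j then σ' k else if k = j then (fun p => σ k p + σ' k p) else σ k)
        (by
          intro k hk p β hp hb
          have a := h k hk p β hp hb
          have b := h' k hk p β hp hb
          have e' : ∀ a b c : ZMod 2, a + c + (b + c) = a + b := by decide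
          by_cases h1 : k < j
          · have h2 : k ≠ j := by omega
            simp [h1, h2, b]
          · by_cases h2 : k = j
            · simp only [h1, h2, lt_irrefl, if_true, if_false]
              rw [← h2, a, b, e', add_zero]
            · simp [h1, h2, a]) j (by omega) (by simp)
      rw [← hz]
      unfold cnt
      rw [← Finset.sum_add_distrib]
      apply Finset.sum_congr rfl
      intro x _
      have hm : j ∈ Finset.range n := Finset.mem_range.2 (by omega)
      rw [← Finset.mul_prod_erase _ _ hm, ← Finset.mul_prod_erase _ _ hm,
        ← Finset.mul_prod_erase _ _ hm]
      have c1 : ∀ k ∈ (Finset.range n).erase j,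
          fac (fun k => if k < j + 1 then σ' k else σ k) (fun _ => 1) k (pt x) =
          fac (fun k => if k < j then σ' k else σ k) (fun _ => 1) k (pt x) := by
        intro k hk
        have : k ≠ j := Finset.ne_of_mem_erase hk
        have : k < j + 1 ↔ k < j := by omega
        simp [fac, this]
      have c2 : ∀ k ∈ (Finset.range n).erase j,
          fac (fun k => if k < j then σ' k else if k = j then (fun p => σ k p + σ' k p) else σ k)
            (fun _ => 1) k (pt x) =
          fac (fun k => if k < j then σ' k else σ k) (fun _ => 1) k (pt x) := by
        intro k hk
        have : k ≠ j := Finset.ne_of_mem_erase hk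
        simp [fac, this]
      rw [Finset.prod_congr rfl c1, Finset.prod_congr rfl c2, ← add_mul]
      congr 1
      simp [fac]
      ring
  rw [main n le_rfl]
  unfold cnt
  apply Finset.sum_congr rfl; intro x _
  apply Finset.prod_congr rfl; intro k hk
  simp [fac, Finset.mem_range.1 hk]


/-- The two blocks. -/
def blk (m : ℕ) (i : Fin (m + m)) : Bool := decide ((i : ℕ) < m)

/-- Characters. -/
def chi (m : ℕ) (k : ℕ) (β : Bool) : ZMod 2 := if β then 1 else if k < m then 0 else 1

/-- Alternating signs in each block. -/
def tw (m : ℕ) (i : ℕ) : ℤ := if i < m then (-1) ^ (i + 1 + m) else (-1) ^ (i + 1)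

lemma tw_abs (m i : ℕ) : |tw m i| = 1 := by
  unfold tw; split_ifs <;> simp

/-- The first extreme coordinate in the block has the twisted sign. -/
def Pos (m : ℕ) (M : ℤ) (β : Bool) (p : Fin (m + m) → ℤ) : Prop :=
  ∃ i, blk m i = β ∧ p i = tw m i * M ∧ ∀ j < i, blk m j = β → |p j| ≠ M

open Classical in
/-- Indicator of `Pos`. -/
noncomputable def sg (m : ℕ) (M : ℤ) (β : Bool) (p : Fin (m + m) → ℤ) : ZMod 2 :=
  if Pos m M β p then 1 else 0

lemma pos_iff {m : ℕ} {M : ℤ} (hM : 0 < M) {β : Bool} {p : Fin (m + m) → ℤ} {i : Fin (m + m)}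
    (h1 : blk m i = β) (h2 : |p i| = M) (h3 : ∀ j < i, blk m j = β → |p j| ≠ M) :
    Pos m M β p ↔ p i = tw m i * M := by
  constructor
  · rintro ⟨i', a, b, c⟩
    have hb : |p i'| = M := by rw [b, abs_mul, tw_abs, one_mul, abs_of_pos hM]
    rcases lt_trichotomy i i' with h | h | h
    · exact absurd h2 (c i h h1)
    · rw [h]; exact b
    · exact absurd hb (h3 i' h a)
  · intro h
    exact ⟨i, h1, h, h3⟩

lemma not_pos {m : ℕ} {M : ℤ} (hM : 0 < M) {β : Bool} {p : Fin (m + m) → ℤ}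
    (h : ∀ j, blk m j = β → |p j| ≠ M) : ¬ Pos m M β p := by
  rintro ⟨i', a, b, c⟩
  have hb : |p i'| = M := by rw [b, abs_mul, tw_abs, one_mul, abs_of_pos hM]
  exact h _ a hb

lemma exists_first {m : ℕ} {M : ℤ} {β : Bool} {p : Fin (m + m) → ℤ}
    (h : ∃ j, blk m j = β ∧ |p j| = M) :
    ∃ i, blk m i = β ∧ |p i| = M ∧ ∀ j < i, blk m j = β → |p j| ≠ M := by
  obtain ⟨i, ⟨a, b⟩, c⟩ := WellFounded.has_min (wellFounded_lt (α := Fin (m + m)))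
    {j | blk m j = β ∧ |p j| = M} h
  exact ⟨i, a, b, fun j hj hb hc => c j ⟨hb, hc⟩ hj⟩

lemma sg_refl {m : ℕ} {M : ℤ} (hM : 0 < M) (β β' : Bool) (p : Fin (m + m) → ℤ)
    (h : ∃ i, blk m i = β' ∧ |p i| = M) :
    sg m M β (refl (blk m) β' p) = sg m M β p + if β = β' then 1 else 0 := by
  by_cases hb : β = β'
  · subst hb
    obtain ⟨i, h1, h2, h3⟩ := exists_first h
    have e1 := pos_iff hM h1 h2 h3
    have e2 : Pos m M β (refl (blk m) β p) ↔ refl (blk m) β p i = tw m i * M := by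
      apply pos_iff hM h1
      · simp [refl, h1, h2]
      · intro j hj hjb
        simpa [refl, hjb] using h3 j hj hjb
    have e3 : refl (blk m) β p i = - p i := by simp [refl, h1]
    have e4 : tw m i * M = M ∨ tw m i * M = - M := by
      rcases (abs_eq (zero_le_one)).1 (tw_abs m i) with h | h <;> simp [h]
    have e5 : p i = M ∨ p i = -M := (abs_eq hM.le).1 h2
    have e6 : (1 : ZMod 2) + 1 = 0 := by decide
    unfold sg
    rw [e2, e1, e3]
    rcases e4 with e4 | e4 <;> rcases e5 with e5 | e5 <;> rw [e4, e5]
    · have : ¬ (-M = M) := by omega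
      simp [this, e6]
    · have : ¬ (-M = M) := by omega
      simp [this]
    · have : ¬ (M = -M) := by omega
      simp [this]
    · have : ¬ (M = -M) := by omega
      simp [this, e6]
  · have : Pos m M β (refl (blk m) β' p) ↔ Pos m M β p := by
      have e : ∀ i, blk m i = β → refl (blk m) β' p i = p i := by
        intro i hi
        simp [refl, hi, hb]
      unfold Pos
      constructor
      · rintro ⟨i, a, b, c⟩
        exact ⟨i, a, by rw [← e i a]; exact b, fun j hj hjb => by rw [← e j hjb]; exact c j hj hjb⟩
      · rintro ⟨i, a, b, c⟩
        exact ⟨i, a, by rw [e i a]; exact b, fun j hj hjb => by rw [e j hjb]; exact c j hj hjb⟩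
    unfold sg
    rw [this, if_neg hb, add_zero]

/-- The standard sign functions. -/
noncomputable def std (m : ℕ) (M : ℤ) (k : ℕ) (p : Fin (m + m) → ℤ) : ZMod 2 :=
  if k < m then sg m M true p else sg m M false p + sg m M true p

lemma std_eqv {m : ℕ} {M : ℤ} (hM : 0 < M) : Eqv M (blk m) (chi m) (std m M) := by
  intro k hk p β hp h
  unfold std chi
  rw [sg_refl hM _ _ _ h, sg_refl hM _ _ _ h]
  cases β <;> split_ifs <;> simp_all <;> ring

lemma sg_step {m : ℕ} {M : ℤ} (hM : 0 < M) (β : Bool) (p p' : Fin (m + m) → ℤ) (i : Fin (m + m))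
    (h : ∀ j, j ≠ i → p j = p' j) (hi : |p' i| ≠ M) (hs : sg m M β p ≠ sg m M β p') :
    blk m i = β ∧ |p i| = M ∧ ∀ j < i, blk m j = β → |p j| ≠ M := by
  by_cases hex : ∃ j, blk m j = β ∧ |p j| = M
  · obtain ⟨i0, h1, h2, h3⟩ := exists_first hex
    by_cases hi0 : i0 = i
    · subst hi0; exact ⟨h1, h2, h3⟩
    · exfalso
      apply hs
      have e1 := pos_iff hM h1 h2 h3
      have e2 : Pos m M β p' ↔ p' i0 = tw m i0 * M := by
        apply pos_iff hM h1
        · rw [← h _ hi0]; exact h2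
        · intro j hj hjb
          by_cases hji : j = i
          · rw [hji]; exact hi
          · rw [← h _ hji]; exact h3 j hj hjb
      unfold sg
      rw [e1, e2, h _ hi0]
  · exfalso
    apply hs
    have e1 : ¬ Pos m M β p := not_pos hM (fun j hj hc => hex ⟨j, hj, hc⟩)
    have e2 : ¬ Pos m M β p' := not_pos hM (fun j hj hc => by
      by_cases hji : j = i
      · rw [hji] at hc; exact hi hc
      · rw [← h _ hji] at hc; exact hex ⟨j, hj, hc⟩)
    simp [sg, e1, e2]

/-- Shape of the flags which count for the standard functions. -/
structure Good {m : ℕ} (M : ℤ)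
    (x : (Fin (m + m) → ℤ) × Equiv.Perm (Fin (m + m)) × (Fin (m + m) → ℤˣ)) : Prop where
  perm : x.2.1 = 1
  ext : ∀ i, x.1 i + (x.2.2 i : ℤ) = x.2.2 i * M
  nex : ∀ i, |x.1 i| ≠ M

/-- sign indicator -/
def ee {m : ℕ} (x : (Fin (m + m) → ℤ) × Equiv.Perm (Fin (m + m)) × (Fin (m + m) → ℤˣ))
    (k : Fin (m + m)) : ZMod 2 := if (x.2.2 k : ℤ) = tw m k then 1 else 0

lemma good_pt_lt {m : ℕ} {M : ℤ}
    {x : (Fin (m + m) → ℤ) × Equiv.Perm (Fin (m + m)) × (Fin (m + m) → ℤˣ)} (hx : Good M x)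
    {k : ℕ} {i : Fin (m + m)} (h : (i : ℕ) < k) : |pt x k i| ≠ M := by
  unfold pt
  rw [hx.perm, if_neg (by simpa using h)]
  exact hx.nex i

lemma good_pt_ge {m : ℕ} {M : ℤ}
    {x : (Fin (m + m) → ℤ) × Equiv.Perm (Fin (m + m)) × (Fin (m + m) → ℤˣ)} (hx : Good M x)
    {k : ℕ} {i : Fin (m + m)} (h : k ≤ (i : ℕ)) : pt x k i = x.2.2 i * M := by
  unfold pt
  rw [hx.perm, if_pos (by simpa using h)]
  exact hx.ext i

lemma good_sg {m : ℕ} {M : ℤ} (hM : 0 < M)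
    {x : (Fin (m + m) → ℤ) × Equiv.Perm (Fin (m + m)) × (Fin (m + m) → ℤˣ)} (hx : Good M x)
    (k : Fin (m + m)) : sg m M (blk m k) (pt x k) = ee x k := by
  have e : Pos m M (blk m k) (pt x k) ↔ pt x k k = tw m k * M := by
    apply pos_iff hM rfl
    · rw [good_pt_ge hx le_rfl, abs_mul, abs_of_pos hM]
      rcases unit_cases (x.2.2 k) with h | h <;> simp [h]
    · intro j hj _
      exact good_pt_lt hx hj
  rw [good_pt_ge hx le_rfl, mul_left_inj' hM.ne'] at e
  unfold sg ee
  simp only [e]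

lemma good_sg_true {m : ℕ} {M : ℤ} (hM : 0 < M)
    {x : (Fin (m + m) → ℤ) × Equiv.Perm (Fin (m + m)) × (Fin (m + m) → ℤˣ)} (hx : Good M x)
    (k : ℕ) (hk : m ≤ k) : sg m M true (pt x k) = 0 := by
  have : ¬ Pos m M true (pt x k) := by
    apply not_pos hM
    intro j hj
    apply good_pt_lt hx
    simp [blk] at hj
    omega
  simp [sg, this]

lemma good_sg_false {m : ℕ} {M : ℤ} (hM : 0 < M)
    {x : (Fin (m + m) → ℤ) × Equiv.Perm (Fin (m + m)) × (Fin (m + m) → ℤˣ)} (hx : Good M x)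
    (k : ℕ) (hk : m + m ≤ k) : sg m M false (pt x k) = 0 := by
  have : ¬ Pos m M false (pt x k) := by
    apply not_pos hM
    intro j hj
    apply good_pt_lt hx
    omega
  simp [sg, this]

lemma good_fac {m : ℕ} {M : ℤ} (hM : 0 < M)
    {x : (Fin (m + m) → ℤ) × Equiv.Perm (Fin (m + m)) × (Fin (m + m) → ℤˣ)} (hx : Good M x)
    (k : ℕ) (hk : k < m + m) :
    fac (std m M) (fun _ => 1) k (pt x) = ee x ⟨k, hk⟩ +
      if h : k + 1 < m + m then (if k + 1 = m then 0 else ee x ⟨k + 1, h⟩) else 0 := by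
  have a := good_sg hM hx ⟨k, hk⟩
  unfold fac std
  by_cases h1 : k < m
  · have b1 : blk m ⟨k, hk⟩ = true := by simp [blk, h1]
    rw [b1] at a
    have h2 : k + 1 < m + m := by omega
    have c := good_sg hM hx ⟨k + 1, h2⟩
    simp only [one_ne_zero, if_false, if_true, h1, h2, dif_pos]
    simp only at a
    rw [a]
    congr 1
    by_cases h3 : k + 1 = m
    · rw [if_pos h3, good_sg_true hM hx _ h3.ge]
    · have b2 : blk m ⟨k + 1, h2⟩ = true := by simp [blk]; omega
      rw [b2] at c
      rw [if_neg h3]; exact c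
  · have b1 : blk m ⟨k, hk⟩ = false := by simp [blk]; omega
    rw [b1] at a
    simp only [one_ne_zero, if_false, if_true, h1]
    simp only at a
    rw [a, good_sg_true hM hx _ (by omega), good_sg_true hM hx _ (by omega), add_zero, add_zero]
    congr 1
    by_cases h2 : k + 1 < m + m
    · rw [dif_pos h2, if_neg (by omega)]
      have c := good_sg hM hx ⟨k + 1, h2⟩
      have b2 : blk m ⟨k + 1, h2⟩ = false := by simp [blk]; omega
      rw [b2] at c
      exact c
    · rw [dif_neg h2, good_sg_false hM hx _ (by omega)]

lemma tw_succ (m k : ℕ) (h : k + 1 ≠ m) : tw m (k + 1) = - tw m k := by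
  unfold tw
  have : k + 1 < m ↔ k < m := by omega
  simp only [this]
  split_ifs <;> ring

lemma tw_last1 (m k : ℕ) (h : k + 1 = m) : tw m k = 1 := by
  unfold tw
  rw [if_pos (by omega)]
  apply Even.neg_one_pow
  exact ⟨m, by omega⟩

lemma tw_last2 (m k : ℕ) (h : k + 1 = m + m) : tw m k = 1 := by
  unfold tw
  split_ifs
  · omega
  · apply Even.neg_one_pow
    exact ⟨m, by omega⟩

/-- The unique counted flag. -/
def x0 (m : ℕ) (M : ℤ) : (Fin (m + m) → ℤ) × Equiv.Perm (Fin (m + m)) × (Fin (m + m) → ℤˣ) :=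
  (fun _ => M - 1, 1, fun _ => 1)

lemma good_x0 (m : ℕ) {M : ℤ} (hM : 1 < M) : Good M (x0 m M) := by
  refine ⟨rfl, ?_, ?_⟩
  · intro i; simp [x0]
  · intro i; simp only [x0]; rw [abs_of_nonneg (by omega)]; omega

lemma ee_x0 {m : ℕ} {M : ℤ} (k : Fin (m + m)) : ee (x0 m M) k = if tw m k = 1 then 1 else 0 := by
  simp [ee, x0, eq_comm]

lemma x0_fac {m : ℕ} {M : ℤ} (hM : 1 < M) (k : ℕ) (hk : k < m + m) :
    fac (std m M) (fun _ => 1) k (pt (x0 m M)) = 1 := by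
  rw [good_fac (by omega) (good_x0 m hM) k hk]
  split_ifs with h1 h2
  · rw [ee_x0, if_pos (tw_last1 m k h2), add_zero]
  · rw [ee_x0, ee_x0]
    simp only [tw_succ m k h2]
    rcases (abs_eq (zero_le_one)).1 (tw_abs m k) with h | h <;> simp [h]
  · rw [ee_x0, if_pos (tw_last2 m k (by omega)), add_zero]

lemma good_unique {m : ℕ} {M : ℤ} (hM : 1 < M)
    {x : (Fin (m + m) → ℤ) × Equiv.Perm (Fin (m + m)) × (Fin (m + m) → ℤˣ)} (hx : Good M x)
    (h : ∀ k < m + m, fac (std m M) (fun _ => 1) k (pt x) ≠ 0) : x = x0 m M := by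
  have key : ∀ j : ℕ, ∀ k (hk : k < m + m), k + 1 + j = m + m → ee x ⟨k, hk⟩ = ee (x0 m M) ⟨k, hk⟩ := by
    have z : ∀ a : ZMod 2, a ≠ 0 → a = 1 := by decide
    intro j
    induction j with
    | zero =>
      intro k hk hj
      have a := z _ (h k hk)
      have b := x0_fac hM k hk
      rw [good_fac (by omega) hx k hk, dif_neg (by omega), add_zero] at a
      rw [good_fac (by omega) (good_x0 m hM) k hk, dif_neg (by omega), add_zero] at b
      rw [a, b]
    | succ j ih =>
      intro k hk hj
      have a := z _ (h k hk)
      have b := x0_fac hM k hk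
      have h1 : k + 1 < m + m := by omega
      rw [good_fac (by omega) hx k hk, dif_pos h1, ih (k + 1) h1 (by omega)] at a
      rw [good_fac (by omega) (good_x0 m hM) k hk, dif_pos h1, ← a] at b
      exact (add_right_cancel b).symm
  have heps : ∀ i, x.2.2 i = 1 := by
    intro i
    have := key (m + m - (i + 1)) i i.2 (by omega)
    simp only [ee, x0, Fin.eta] at this
    rcases Int.units_eq_one_or (x.2.2 i) with h | h
    · exact h
    · exfalso
      rw [h] at this
      rcases (abs_eq (zero_le_one)).1 (tw_abs m i) with h | h <;> rw [h] at this <;> simp at this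
  have hq : ∀ i, x.1 i = M - 1 := by
    intro i
    have := hx.ext i
    rw [heps i] at this
    simp at this
    omega
  refine Prod.ext (funext hq) (Prod.ext hx.perm (funext heps))

lemma good_of {m : ℕ} {M : ℤ} (hM : 1 < M) (hMe : Even M)
    {x : (Fin (m + m) → ℤ) × Equiv.Perm (Fin (m + m)) × (Fin (m + m) → ℤˣ)}
    (hx : x ∈ Fl (m + m) M)
    (h : ∀ k < m + m, fac (std m M) (fun _ => 1) k (pt x) ≠ 0) : Good M x := by
  have hodd : ∀ i, |x.1 i| ≠ M := by
    intro i hi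
    obtain ⟨_, ho⟩ := mem_Fl.1 hx i
    have : Odd |x.1 i| := odd_abs.2 ho
    rw [hi] at this
    exact (Int.not_even_iff_odd.2 this) hMe
  have hoff : ∀ (k : Fin (m + m)) j, j ≠ x.2.1.symm k → pt x k j = pt x (k + 1) j := by
    intro k j hj
    unfold pt
    have : (k : ℕ) ≠ x.2.1 j := by
      intro hc
      apply hj
      rw [Equiv.eq_symm_apply]
      exact (Fin.ext hc).symm
    have : (k : ℕ) ≤ x.2.1 j ↔ (k : ℕ) + 1 ≤ x.2.1 j := by omega
    simp only [this]
  have hnew : ∀ k : Fin (m + m), |pt x (k + 1) (x.2.1.symm k)| ≠ M := by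
    intro k
    unfold pt
    rw [if_neg (by simp)]
    exact hodd _
  have s1 : ∀ k : Fin (m + m), (k : ℕ) < m → blk m (x.2.1.symm k) = true ∧
      |pt x k (x.2.1.symm k)| = M ∧ ∀ j < x.2.1.symm k, blk m j = true → |pt x k j| ≠ M := by
    intro k hk
    apply sg_step (by omega) true _ _ _ (hoff k) (hnew k)
    have := h k k.2
    simp only [fac, std, hk, one_ne_zero, if_true, if_false] at this
    intro hc
    apply this
    rw [hc, CharTwo.add_self_eq_zero]
  have mp : ∀ k : Fin (m + m), (k : ℕ) < m → ((x.2.1.symm k : Fin (m + m)) : ℕ) < m := by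
    intro k hk
    simpa [blk] using (s1 k hk).1
  have mp' : ∀ k : Fin (m + m), (k : ℕ) < m → ((x.2.1 k : Fin (m + m)) : ℕ) < m := by
    have := Equiv.Perm.perm_symm_mapsTo_of_mapsTo (x.2.1.symm) (s := {k | (k : ℕ) < m}) (fun k hk => mp k hk)
    intro k hk
    exact this hk
  have s2 : ∀ k : Fin (m + m), m ≤ (k : ℕ) → blk m (x.2.1.symm k) = false ∧
      |pt x k (x.2.1.symm k)| = M ∧ ∀ j < x.2.1.symm k, blk m j = false → |pt x k j| ≠ M := by
    intro k hk
    apply sg_step (by omega) false _ _ _ (hoff k) (hnew k)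
    have := h k k.2
    have hz : ∀ l, m ≤ l → sg m M true (pt x l) = 0 := by
      intro l hl
      have : ¬ Pos m M true (pt x l) := by
        apply not_pos (by omega)
        intro j hj
        unfold pt
        have := mp' j (by simpa [blk] using hj)
        rw [if_neg (by omega)]
        exact hodd _
      simp [sg, this]
    simp only [fac, std, not_lt.2 hk, one_ne_zero, if_true, if_false] at this
    rw [hz _ hk, hz _ (by omega), add_zero, add_zero] at this
    intro hc
    apply this
    rw [hc, CharTwo.add_self_eq_zero]
  have hext : ∀ i, |x.1 i + (x.2.2 i : ℤ)| = M := by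
    intro i
    have e : pt x (x.2.1 i) i = x.1 i + (x.2.2 i : ℤ) := by unfold pt; rw [if_pos le_rfl]
    rw [← e]
    by_cases hk : ((x.2.1 i : Fin (m + m)) : ℕ) < m
    · simpa using (s1 _ hk).2.1
    · simpa using (s2 _ (not_lt.1 hk)).2.1
  have hpt : ∀ l j, |pt x l j| ≠ M → ((x.2.1 j : Fin (m + m)) : ℕ) < l := by
    intro l j hlj
    by_contra hc
    apply hlj
    unfold pt
    rw [if_pos (by omega)]
    exact hext j
  have hmono : StrictMono x.2.1 := by
    intro j i hji
    rw [Fin.lt_def]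
    by_cases hk : ((x.2.1 i : Fin (m + m)) : ℕ) < m
    · have a := s1 _ hk
      rw [Equiv.symm_apply_apply] at a
      apply hpt
      apply a.2.2 j hji
      have := a.1
      simp [blk] at this ⊢
      omega
    · have a := s2 _ (not_lt.1 hk)
      rw [Equiv.symm_apply_apply] at a
      by_cases hj : (j : ℕ) < m
      · have := mp' j hj
        omega
      · apply hpt
        apply a.2.2 j hji
        simp [blk]; omega
  refine ⟨?_, ?_, hodd⟩
  · have : (hmono.orderIsoOfSurjective _ x.2.1.surjective) = OrderIso.refl _ :=
      Subsingleton.elim _ _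
    ext i
    have := congrArg (fun f => ((f i : Fin (m + m)) : ℕ)) this
    simpa using this
  · intro i
    obtain ⟨⟨h1, h2⟩, _⟩ := mem_Fl.1 hx i
    have a := hodd i
    rcases (abs_eq (by omega)).1 (hext i) with h | h <;>
      rcases unit_cases (x.2.2 i) with h' | h' <;> rw [h'] at h ⊢ <;> try omega

lemma cnt_std {m : ℕ} {M : ℤ} (hM : 1 < M) (hMe : Even M) :
    cnt M (std m M) (fun _ => 1) = 1 := by
  unfold cnt
  rw [Finset.sum_eq_single (x0 m M)]
  · apply Finset.prod_eq_one
    intro k hk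
    exact x0_fac hM k (Finset.mem_range.1 hk)
  · intro x hx hne
    by_contra hc
    rw [← ne_eq, Finset.prod_ne_zero_iff] at hc
    have hc' : ∀ k < m + m, fac (std m M) (fun _ => 1) k (pt x) ≠ 0 :=
      fun k hk => hc k (Finset.mem_range.2 hk)
    exact hne (good_unique hM (good_of hM hMe hx hc') hc')
  · intro hc
    exfalso
    apply hc
    rw [mem_Fl]
    intro i
    simp only [x0]
    refine ⟨by omega, ?_⟩
    obtain ⟨N, hN⟩ := hMe
    exact ⟨N - 1, by omega⟩

/-- The combinatorial existence theorem. -/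
theorem comb {m : ℕ} {M : ℤ} (hM : 1 < M) (hMe : Even M)
    (σ : ℕ → (Fin (m + m) → ℤ) → ZMod 2) (h : Eqv M (blk m) (chi m) σ) :
    ∃ x ∈ Fl (m + m) M, ∀ k < m + m, σ k (pt x k) ≠ σ k (pt x (k + 1)) := by
  have e : cnt M σ (fun _ => 1) = 1 := by
    rw [cnt_indep hMe (blk m) (chi m) σ (std m M) h (std_eqv (by omega)), cnt_std hM hMe]
  by_contra hc
  push Not at hc
  have : cnt M σ (fun _ => 1) = 0 := by
    unfold cnt
    apply Finset.sum_eq_zero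
    intro x hx
    obtain ⟨k, hk, hk'⟩ := hc x hx
    apply Finset.prod_eq_zero (Finset.mem_range.2 hk)
    simp [fac, hk', CharTwo.add_self_eq_zero]
  rw [this] at e
  exact absurd e (by decide)


/-- The continuous zero theorem on the product of two cubes. -/
theorem zero_exists {m : ℕ} (φ : ℕ → (Fin (m + m) → ℝ) → ℝ)
    (hc : ∀ k < m + m, Continuous (φ k))
    (hB : ∀ k < m + m, ∀ p : Fin (m + m) → ℝ, (∀ i, |p i| ≤ 1) →
      (∃ i, blk m i = true ∧ |p i| = 1) → φ k (refl (blk m) true p) = - φ k p)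
    (hA1 : ∀ k < m, ∀ p : Fin (m + m) → ℝ, (∀ i, |p i| ≤ 1) →
      (∃ i, blk m i = false ∧ |p i| = 1) → φ k (refl (blk m) false p) = φ k p)
    (hA2 : ∀ k, m ≤ k → k < m + m → ∀ p : Fin (m + m) → ℝ, (∀ i, |p i| ≤ 1) →
      (∃ i, blk m i = false ∧ |p i| = 1) → φ k (refl (blk m) false p) = - φ k p) :
    ∃ p, ∀ k < m + m, φ k p = 0 := by
  classical
  -- scaled points
  let sc : ℕ → (Fin (m + m) → ℤ) → (Fin (m + m) → ℝ) := fun N p i => (p i : ℝ) / (2 * (N + 1))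
  have step : ∀ N : ℕ, ∃ x ∈ Fl (m + m) (2 * ((N : ℤ) + 1)), ∀ k < m + m,
      φ k (sc N (pt x k)) * φ k (sc N (pt x (k + 1))) ≤ 0 := by
    intro N
    have hM : (1 : ℤ) < 2 * ((N : ℤ) + 1) := by omega
    have hMe : Even (2 * ((N : ℤ) + 1)) := even_two_mul _
    have hMr : (0 : ℝ) < 2 * ((N : ℝ) + 1) := by positivity
    let σ : ℕ → (Fin (m + m) → ℤ) → ZMod 2 := fun k p =>
      if φ k (sc N p) < 0 then 1 else if φ k (sc N p) = 0 then std m (2 * ((N : ℤ) + 1)) k p else 0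
    have hσ : Eqv (2 * ((N : ℤ) + 1)) (blk m) (chi m) σ := by
      intro k hk p β hp hex
      have hst := std_eqv (m := m) (M := 2 * ((N : ℤ) + 1)) (by omega) k hk p β hp hex
      have e1 : sc N (refl (blk m) β p) = refl (blk m) β (sc N p) := by
        funext i
        simp only [sc, refl]
        split_ifs
        · push_cast; ring
        · rfl
      have habs : ∀ i, |sc N p i| = (|p i| : ℤ) / (2 * ((N : ℝ) + 1)) := by
        intro i
        simp only [sc]
        rw [abs_div, abs_of_pos hMr]
        push_cast
        rfl
      have e2 : ∀ i, |sc N p i| ≤ 1 := by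
        intro i
        rw [habs, div_le_one hMr]
        exact_mod_cast hp i
      have e3 : ∃ i, blk m i = β ∧ |sc N p i| = 1 := by
        obtain ⟨i, hi, hi'⟩ := hex
        refine ⟨i, hi, ?_⟩
        rw [habs, hi', div_eq_one_iff_eq hMr.ne']
        push_cast; rfl
      have key : (chi m k β = 0 ∧ φ k (refl (blk m) β (sc N p)) = φ k (sc N p)) ∨
          (chi m k β = 1 ∧ φ k (refl (blk m) β (sc N p)) = - φ k (sc N p)) := by
        cases β
        · by_cases hkm : k < m
          · left
            exact ⟨by simp [chi, hkm], hA1 k hkm _ e2 e3⟩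
          · right
            exact ⟨by simp [chi, hkm], hA2 k (by omega) hk _ e2 e3⟩
        · right
          exact ⟨by simp [chi], hB k hk _ e2 e3⟩
      have e11 : (1 : ZMod 2) + 1 = 0 := by decide
      simp only [σ]
      rw [e1]
      rcases key with ⟨hx, hy⟩ | ⟨hx, hy⟩
      · rw [hy, hst, hx]; simp
      · rw [hy, hst, hx]
        rcases lt_trichotomy (φ k (sc N p)) 0 with h | h | h
        · have h1 : ¬ (- φ k (sc N p) < 0) := by linarith
          have h2 : ¬ (- φ k (sc N p) = 0) := by intro h'; linarith
          rw [if_neg h1, if_neg h2, if_pos h, e11]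
        · simp [h]
        · have h1 : (- φ k (sc N p) < 0) := by linarith
          have h2 : ¬ (φ k (sc N p) < 0) := by linarith
          rw [if_pos h1, if_neg h2, if_neg h.ne', zero_add]
    obtain ⟨x, hx, hx'⟩ := comb hM hMe σ hσ
    refine ⟨x, hx, fun k hk => ?_⟩
    by_contra hcon
    push Not at hcon
    apply hx' k hk
    simp only [σ]
    rcases mul_pos_iff.1 hcon with ⟨h1, h2⟩ | ⟨h1, h2⟩
    · rw [if_neg h1.not_gt, if_neg h1.ne', if_neg h2.not_gt, if_neg h2.ne']
    · rw [if_pos h1, if_pos h2]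
  choose x hx hxk using step
  let P : ℕ → ℕ → (Fin (m + m) → ℝ) := fun l N => sc N (pt (x N) l)
  have hbox : ∀ N, P 0 N ∈ Metric.closedBall (0 : Fin (m + m) → ℝ) 1 := by
    intro N
    have hMr : (0 : ℝ) < 2 * ((N : ℝ) + 1) := by positivity
    rw [mem_closedBall_zero_iff, pi_norm_le_iff_of_nonneg zero_le_one]
    intro i
    have := pt_box (even_two_mul _) (hx N) 0 i
    simp only [P, sc]
    rw [Real.norm_eq_abs, abs_div, abs_of_pos hMr, div_le_one hMr]
    exact_mod_cast this
  obtain ⟨p, _, g, hg, hlim⟩ := (isCompact_closedBall (0 : Fin (m + m) → ℝ) 1).tendsto_subseq hbox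
  have hPl : ∀ l, Filter.Tendsto (P l ∘ g) Filter.atTop (nhds p) := by
    intro l
    rw [tendsto_pi_nhds] at hlim ⊢
    intro i
    have h0 := hlim i
    have hz : Filter.Tendsto (fun N => (P l ∘ g) N i - (P 0 ∘ g) N i) Filter.atTop (nhds 0) := by
      have hb : Filter.Tendsto (fun N : ℕ => 1 / ((g N : ℝ) + 1)) Filter.atTop (nhds 0) :=
        tendsto_one_div_add_atTop_nhds_zero_nat.comp hg.tendsto_atTop
      apply squeeze_zero_norm _ hb
      intro N
      have hMr : (0 : ℝ) < ((g N : ℝ) + 1) := by positivity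
      have hd : |((pt (x (g N)) l i : ℤ) : ℝ) - ((pt (x (g N)) 0 i : ℤ) : ℝ)| ≤ 1 := by
        have : |pt (x (g N)) l i - pt (x (g N)) 0 i| ≤ 1 := by
          unfold pt
          rw [abs_le]
          rcases unit_cases ((x (g N)).2.2 i) with h | h <;> split_ifs <;> constructor <;> omega
        exact_mod_cast this
      simp only [Function.comp, P, sc]
      rw [← sub_div, Real.norm_eq_abs, abs_div, abs_of_pos (by positivity : (0:ℝ) < 2 * ((g N : ℝ) + 1))]
      rw [div_le_div_iff₀ (by positivity) hMr]
      nlinarith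
    have := hz.add h0
    simpa using this
  refine ⟨p, fun k hk => ?_⟩
  have t1 := ((hc k hk).tendsto p).comp (hPl k)
  have t2 := ((hc k hk).tendsto p).comp (hPl (k + 1))
  have t3 := le_of_tendsto (t1.mul t2) (Filter.Eventually.of_forall (fun N => hxk (g N) k hk))
  nlinarith [mul_self_nonneg (φ k p), mul_self_eq_zero.1 (le_antisymm t3 (mul_self_nonneg (φ k p)))]


open Topology Filter in
lemma ev_lt {d : ℕ} {X : Type*} [TopologicalSpace X] {V : X → EuclideanSpace ℝ (Fin d)} {S : X → ℝ}
    {x0 : X} (hV : ContinuousAt V x0) (hS : ContinuousAt S x0) (y : EuclideanSpace ℝ (Fin d))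
    (h : (inner ℝ y (V x0) : ℝ) ≠ S x0) :
    ∀ᶠ x in 𝓝 x0, ((inner ℝ y (V x) : ℝ) < S x ↔ (inner ℝ y (V x0) : ℝ) < S x0) ∧
      (S x < (inner ℝ y (V x) : ℝ) ↔ S x0 < (inner ℝ y (V x0) : ℝ)) := by
  have hc : ContinuousAt (fun x => (inner ℝ y (V x) : ℝ)) x0 := continuousAt_const.inner hV
  rcases lt_or_gt_of_ne h with h | h
  · filter_upwards [hc.eventually_lt hS h] with x hx
    exact ⟨iff_of_true hx h, iff_of_false hx.not_gt h.not_gt⟩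
  · filter_upwards [hS.eventually_lt hc h] with x hx
    exact ⟨iff_of_false hx.not_gt h.not_gt, iff_of_true hx h⟩

open Topology Filter in
lemma cont_meas {d : ℕ} (μ : Measure (EuclideanSpace ℝ (Fin d))) [IsFiniteMeasure μ]
    {X : Type*} [TopologicalSpace X] [FirstCountableTopology X]
    (A : X → Set (EuclideanSpace ℝ (Fin d))) (x0 : X) (hA : ∀ x, MeasurableSet (A x))
    (h : ∀ᵐ y ∂μ, ∀ᶠ x in 𝓝 x0, (y ∈ A x ↔ y ∈ A x0)) :
    ContinuousAt (fun x => μ.real (A x)) x0 := by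
  have := tendsto_measure_of_ae_tendsto_indicator_of_isFiniteMeasure (μ := μ) (𝓝 x0) (hA x0) hA h
  exact (ENNReal.tendsto_toReal (measure_ne_top μ _)).comp this

lemma null_hyper {d : ℕ} (μ : Measure (EuclideanSpace ℝ (Fin d))) (hac : μ ≪ volume)
    (v : EuclideanSpace ℝ (Fin d)) (s : ℝ) (h : v ≠ 0 ∨ s ≠ 0) :
    μ {x | (inner ℝ x v : ℝ) = s} = 0 := by
  apply hac
  by_cases hv : v = 0
  · have : {x : EuclideanSpace ℝ (Fin d) | (inner ℝ x v : ℝ) = s} = ∅ := by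
      ext x
      have hs : s ≠ 0 := by tauto
      simp [hv, Ne.symm hs]
    rw [this]; simp
  · let P : AffineSubspace ℝ (EuclideanSpace ℝ (Fin d)) :=
      { carrier := {x | (inner ℝ x v : ℝ) = s}
        smul_vsub_vadd_mem' := by
          intro c p1 p2 p3 h1 h2 h3
          simp only [Set.mem_ofPred_eq, vsub_eq_sub, vadd_eq_add, inner_add_left, inner_smul_left,
            inner_sub_left] at *
          simp [h1, h2, h3] }
    have hP : P ≠ ⊤ := by
      intro hP
      have : ((s + 1) / (inner ℝ v v : ℝ)) • v ∈ P := by rw [hP]; trivial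
      change (inner ℝ (((s + 1) / (inner ℝ v v : ℝ)) • v) v : ℝ) = s at this
      rw [real_inner_smul_left, div_mul_cancel₀ _ (by simpa using hv)] at this
      linarith
    exact Measure.addHaar_affineSubspace volume P hP

lemma meas_lt {d : ℕ} (u : EuclideanSpace ℝ (Fin d)) (t : ℝ) :
    MeasurableSet {x : EuclideanSpace ℝ (Fin d) | (inner ℝ x u : ℝ) < t} :=
  (isOpen_lt (by fun_prop) (by fun_prop)).measurableSet

lemma meas_gt {d : ℕ} (u : EuclideanSpace ℝ (Fin d)) (t : ℝ) :
    MeasurableSet {x : EuclideanSpace ℝ (Fin d) | t < (inner ℝ x u : ℝ)} :=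
  (isOpen_lt (by fun_prop) (by fun_prop)).measurableSet

/-- Distribution function in direction `u`. -/
noncomputable def Fq {d : ℕ} (μ : Measure (EuclideanSpace ℝ (Fin d))) (u : EuclideanSpace ℝ (Fin d))
    (t : ℝ) : ℝ := μ.real {x | (inner ℝ x u : ℝ) < t}

lemma Fq_strict {d : ℕ} (μ : Measure (EuclideanSpace ℝ (Fin d))) [IsFiniteMeasure μ]
    (hpos : ∀ U : Set (EuclideanSpace ℝ (Fin d)), IsOpen U → U.Nonempty → 0 < μ U)
    {u : EuclideanSpace ℝ (Fin d)} (hu : u ≠ 0) : StrictMono (Fq μ u) := by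
  intro t t' htt
  have hd : Disjoint {x : EuclideanSpace ℝ (Fin d) | (inner ℝ x u : ℝ) < t}
      {x | t < (inner ℝ x u : ℝ) ∧ (inner ℝ x u : ℝ) < t'} := by
    rw [Set.disjoint_left]; intro x h1 h2; exact absurd h1 (not_lt.2 h2.1.le)
  have ho : IsOpen {x : EuclideanSpace ℝ (Fin d) | t < (inner ℝ x u : ℝ) ∧ (inner ℝ x u : ℝ) < t'} :=
    IsOpen.inter (s := {x : EuclideanSpace ℝ (Fin d) | t < (inner ℝ x u : ℝ)})
      (t := {x : EuclideanSpace ℝ (Fin d) | (inner ℝ x u : ℝ) < t'})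
      (isOpen_lt (by fun_prop) (by fun_prop)) (isOpen_lt (by fun_prop) (by fun_prop))
  have hne : {x : EuclideanSpace ℝ (Fin d) | t < (inner ℝ x u : ℝ) ∧ (inner ℝ x u : ℝ) < t'}.Nonempty := by
    refine ⟨(((t + t') / 2) / (inner ℝ u u : ℝ)) • u, ?_⟩
    simp only [Set.mem_ofPred_eq]
    rw [real_inner_smul_left, div_mul_cancel₀ _ (by simpa using hu)]
    constructor <;> linarith
  have h1 := measureReal_union (μ := μ) hd ho.measurableSet
  have h2 : 0 < μ.real {x : EuclideanSpace ℝ (Fin d) | t < (inner ℝ x u : ℝ) ∧ (inner ℝ x u : ℝ) < t'} :=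
    ENNReal.toReal_pos (hpos _ ho hne).ne' (measure_ne_top μ _)
  have h3 : μ.real ({x : EuclideanSpace ℝ (Fin d) | (inner ℝ x u : ℝ) < t} ∪
      {x | t < (inner ℝ x u : ℝ) ∧ (inner ℝ x u : ℝ) < t'}) ≤ Fq μ u t' := by
    refine measureReal_mono ?_ (measure_ne_top μ _)
    rintro x (h | h)
    · exact lt_trans h htt
    · exact h.2
  have : Fq μ u t = μ.real {x : EuclideanSpace ℝ (Fin d) | (inner ℝ x u : ℝ) < t} := rfl
  linarith

lemma Fq_cont {d : ℕ} (μ : Measure (EuclideanSpace ℝ (Fin d))) [IsFiniteMeasure μ] (hac : μ ≪ volume)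
    (u0 : EuclideanSpace ℝ (Fin d)) (hu : u0 ≠ 0) (t0 : ℝ) :
    ContinuousAt (fun q : EuclideanSpace ℝ (Fin d) × ℝ => Fq μ q.1 q.2) (u0, t0) := by
  apply cont_meas μ (fun q : EuclideanSpace ℝ (Fin d) × ℝ => {x | (inner ℝ x q.1 : ℝ) < q.2}) (u0, t0)
    (fun q => meas_lt _ _)
  have h0 := null_hyper μ hac u0 t0 (Or.inl hu)
  filter_upwards [compl_mem_ae_iff.2 h0] with y hy
  filter_upwards [ev_lt (V := fun q : EuclideanSpace ℝ (Fin d) × ℝ => q.1) (S := fun q => q.2)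
    (x0 := (u0, t0)) (by fun_prop) (by fun_prop) y hy] with q hq
  exact hq.1

open Filter Topology in
lemma Fq_ex {d : ℕ} (μ : Measure (EuclideanSpace ℝ (Fin d))) [IsFiniteMeasure μ] (hac : μ ≪ volume)
    {u : EuclideanSpace ℝ (Fin d)} (hu : u ≠ 0) {c : ℝ} (h0 : 0 < c) (h1 : c < μ.real Set.univ) :
    ∃ t, Fq μ u t = c := by
  have hc : Continuous (Fq μ u) := by
    rw [continuous_iff_continuousAt]; intro t
    exact (Fq_cont μ hac u hu t).comp (f := fun t => (u, t)) (by fun_prop)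
  have hbot : Tendsto (Fq μ u) atBot (𝓝 0) := by
    have := tendsto_measure_of_tendsto_indicator_of_isFiniteMeasure (μ := μ)
      (As := fun t : ℝ => {x : EuclideanSpace ℝ (Fin d) | (inner ℝ x u : ℝ) < t}) (A := ∅) atBot
      (fun t => meas_lt _ _) (fun x => by
        filter_upwards [eventually_le_atBot (inner ℝ x u : ℝ)] with t ht
        simpa using ht)
    have h2 := (ENNReal.tendsto_toReal (measure_ne_top μ _)).comp this
    rw [measure_empty, ENNReal.toReal_zero] at h2
    exact h2
  have htop : Tendsto (Fq μ u) atTop (𝓝 (μ.real Set.univ)) := by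
    have := tendsto_measure_of_tendsto_indicator_of_isFiniteMeasure (μ := μ)
      (As := fun t : ℝ => {x : EuclideanSpace ℝ (Fin d) | (inner ℝ x u : ℝ) < t}) (A := Set.univ) atTop
      (fun t => meas_lt _ _) (fun x => by
        filter_upwards [eventually_gt_atTop (inner ℝ x u : ℝ)] with t ht
        simpa using ht)
    exact (ENNReal.tendsto_toReal (measure_ne_top μ _)).comp this
  obtain ⟨a, ha⟩ := (hbot.eventually_lt_const h0).exists
  obtain ⟨b, hb⟩ := (htop.eventually_const_lt h1).exists
  exact mem_range_of_exists_le_of_exists_ge hc ⟨a, ha.le⟩ ⟨b, hb.le⟩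

/-- Quantile in direction `u`. -/
noncomputable def qt {d : ℕ} (μ : Measure (EuclideanSpace ℝ (Fin d))) (u : EuclideanSpace ℝ (Fin d))
    (c : ℝ) : ℝ := Classical.epsilon (fun t => Fq μ u t = c)

lemma qt_spec {d : ℕ} (μ : Measure (EuclideanSpace ℝ (Fin d))) [IsFiniteMeasure μ] (hac : μ ≪ volume)
    {u : EuclideanSpace ℝ (Fin d)} (hu : u ≠ 0) {c : ℝ} (h0 : 0 < c) (h1 : c < μ.real Set.univ) :
    Fq μ u (qt μ u c) = c := Classical.epsilon_spec (Fq_ex μ hac hu h0 h1)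

open Filter Topology in
lemma qt_cont {d : ℕ} (μ : Measure (EuclideanSpace ℝ (Fin d))) [IsFiniteMeasure μ] (hac : μ ≪ volume)
    (hpos : ∀ U : Set (EuclideanSpace ℝ (Fin d)), IsOpen U → U.Nonempty → 0 < μ U)
    {u : EuclideanSpace ℝ (Fin d)} (hu : u ≠ 0) {c : ℝ} (h0 : 0 < c) (h1 : c < μ.real Set.univ) :
    ContinuousAt (fun u => qt μ u c) u := by
  have hs := qt_spec μ hac hu h0 h1
  have hm := Fq_strict μ hpos hu
  have hu' : ∀ᶠ w in 𝓝 u, w ≠ 0 := isOpen_ne.mem_nhds hu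
  have hcc : ∀ t, ContinuousAt (fun w => Fq μ w t) u := fun t =>
    (Fq_cont μ hac u hu t).comp (f := fun w => (w, t)) (by fun_prop)
  rw [ContinuousAt, tendsto_order]
  constructor
  · intro a ha
    have : Fq μ u a < c := by rw [← hs]; exact hm ha
    filter_upwards [(hcc a).eventually_lt_const this, hu'] with w hw hw0
    rw [← (Fq_strict μ hpos hw0).lt_iff_lt, qt_spec μ hac hw0 h0 h1]; exact hw
  · intro a ha
    have : c < Fq μ u a := by rw [← hs]; exact hm ha
    filter_upwards [(hcc a).eventually_const_lt this, hu'] with w hw hw0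
    rw [← (Fq_strict μ hpos hw0).lt_iff_lt, qt_spec μ hac hw0 h0 h1]; exact hw

lemma real_split {d : ℕ} (μ : Measure (EuclideanSpace ℝ (Fin d))) [IsFiniteMeasure μ] (hac : μ ≪ volume)
    (v : EuclideanSpace ℝ (Fin d)) (s : ℝ) (h : v ≠ 0 ∨ s ≠ 0) (A : Set (EuclideanSpace ℝ (Fin d))) :
    μ.real A = μ.real (A ∩ {x | (inner ℝ x v : ℝ) < s}) + μ.real (A ∩ {x | s < (inner ℝ x v : ℝ)}) := by
  rw [← measureReal_inter_add_sdiff (μ := μ) (s := A) (meas_lt v s)]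
  congr 1
  apply measureReal_congr
  filter_upwards [compl_mem_ae_iff.2 (null_hyper μ hac v s h)] with y hy
  have hy' : (inner ℝ y v : ℝ) ≠ s := hy
  apply propext
  change (y ∈ A ∧ ¬ (inner ℝ y v : ℝ) < s) ↔ (y ∈ A ∧ s < (inner ℝ y v : ℝ))
  rw [not_lt, le_iff_lt_or_eq]
  simp [hy'.symm]

lemma Fq_neg {d : ℕ} (μ : Measure (EuclideanSpace ℝ (Fin d))) [IsFiniteMeasure μ] (hac : μ ≪ volume)
    {u : EuclideanSpace ℝ (Fin d)} (hu : u ≠ 0) (t : ℝ) :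
    Fq μ (-u) (-t) = μ.real Set.univ - Fq μ u t := by
  have := real_split μ hac u t (Or.inl hu) Set.univ
  simp only [Set.univ_inter] at this
  simp only [Fq, inner_neg_right, neg_lt_neg_iff]
  linarith

lemma qt_neg {d : ℕ} (μ : Measure (EuclideanSpace ℝ (Fin d))) [IsFiniteMeasure μ] (hac : μ ≪ volume)
    (hpos : ∀ U : Set (EuclideanSpace ℝ (Fin d)), IsOpen U → U.Nonempty → 0 < μ U)
    {u : EuclideanSpace ℝ (Fin d)} (hu : u ≠ 0) {c : ℝ} (h0 : 0 < c) (h1 : c < μ.real Set.univ) :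
    qt μ (-u) c = - qt μ u (μ.real Set.univ - c) := by
  apply (Fq_strict μ hpos (neg_ne_zero.2 hu)).injective
  rw [Fq_neg μ hac hu, qt_spec μ hac hu (by linarith) (by linarith),
    qt_spec μ hac (neg_ne_zero.2 hu) h0 h1]
  ring

lemma meas_imp {d : ℕ} (P : Prop) {A : Set (EuclideanSpace ℝ (Fin d))} (hA : MeasurableSet A) :
    MeasurableSet {x | P → x ∈ A} := by
  by_cases h : P
  · simpa [h] using hA
  · simp [h]

lemma meas_slab {d : ℕ} (u : EuclideanSpace ℝ (Fin d)) (t : ℕ → ℝ) (n i : ℕ) :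
    MeasurableSet (slab u t n i) :=
  (meas_imp (1 ≤ i) (meas_gt u (t i))).inter (meas_imp (i + 1 ≤ n) (meas_lt u (t (i + 1))))

lemma box_cont {d : ℕ} (μ : Measure (EuclideanSpace ℝ (Fin d))) [IsFiniteMeasure μ] (hac : μ ≪ volume)
    {X : Type*} [TopologicalSpace X] [FirstCountableTopology X]
    (U V : X → EuclideanSpace ℝ (Fin d)) (S : X → ℝ) (T : X → ℕ → ℝ) (x0 : X)
    (hU : ContinuousAt U x0) (hV : ContinuousAt V x0) (hS : ContinuousAt S x0)
    (hT : ∀ i, ContinuousAt (fun x => T x i) x0) (hU0 : U x0 ≠ 0) (hVS : V x0 ≠ 0 ∨ S x0 ≠ 0)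
    (N i : ℕ) :
    ContinuousAt (fun x => μ.real (slab (U x) (T x) N i ∩ {y | (inner ℝ y (V x) : ℝ) < S x})) x0 ∧
    ContinuousAt (fun x => μ.real (slab (U x) (T x) N i ∩ {y | S x < (inner ℝ y (V x) : ℝ)})) x0 := by
  have n1 := compl_mem_ae_iff.2 (null_hyper μ hac (U x0) (T x0 i) (Or.inl hU0))
  have n2 := compl_mem_ae_iff.2 (null_hyper μ hac (U x0) (T x0 (i + 1)) (Or.inl hU0))
  have n3 := compl_mem_ae_iff.2 (null_hyper μ hac (V x0) (S x0) hVS)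
  constructor
  · apply cont_meas μ _ x0 (fun x => (meas_slab _ _ _ _).inter (meas_lt _ _))
    filter_upwards [n1, n2, n3] with y h1 h2 h3
    filter_upwards [ev_lt hU (hT i) y h1, ev_lt hU (hT (i + 1)) y h2, ev_lt hV hS y h3] with x e1 e2 e3
    exact and_congr (and_congr (imp_congr Iff.rfl e1.2) (imp_congr Iff.rfl e2.1)) e3.1
  · apply cont_meas μ _ x0 (fun x => (meas_slab _ _ _ _).inter (meas_gt _ _))
    filter_upwards [n1, n2, n3] with y h1 h2 h3
    filter_upwards [ev_lt hU (hT i) y h1, ev_lt hU (hT (i + 1)) y h2, ev_lt hV hS y h3] with x e1 e2 e3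
    exact and_congr (and_congr (imp_congr Iff.rfl e1.2) (imp_congr Iff.rfl e2.1)) e3.2

lemma slab_meas {d : ℕ} (μ : Measure (EuclideanSpace ℝ (Fin d))) [IsFiniteMeasure μ] (hac : μ ≪ volume)
    {u : EuclideanSpace ℝ (Fin d)} (hu : u ≠ 0) (T : ℕ → ℝ) (N : ℕ)
    (hT : ∀ i, 1 ≤ i → i ≤ N → Fq μ u (T i) = (i : ℝ) / (N + 1) * μ.real Set.univ)
    (hm : ∀ i, 1 ≤ i → i + 1 ≤ N → T i < T (i + 1)) (i : ℕ) (hi : i ≤ N) :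
    μ.real (slab u T N i) = μ.real Set.univ / (N + 1) := by
  have hN : (0 : ℝ) < N + 1 := by positivity
  have hA : μ.real {x | i + 1 ≤ N → (inner ℝ x u : ℝ) < T (i + 1)} =
      ((i : ℝ) + 1) / (N + 1) * μ.real Set.univ := by
    by_cases h : i + 1 ≤ N
    · have := hT (i + 1) (by omega) h
      simpa [h, Fq] using this
    · have h' : i = N := by omega
      have : {x : EuclideanSpace ℝ (Fin d) | i + 1 ≤ N → (inner ℝ x u : ℝ) < T (i + 1)} = Set.univ := by
        ext x; simp [h]
      rw [this, h', div_self hN.ne', one_mul]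
  by_cases h0 : i = 0
  · have : slab u T N i = {x | i + 1 ≤ N → (inner ℝ x u : ℝ) < T (i + 1)} := by
      ext x; simp [slab, h0]
    rw [this, hA, h0]; simp; ring
  · have h1 : 1 ≤ i := by omega
    have hs := real_split μ hac u (T i) (Or.inl hu) {x | i + 1 ≤ N → (inner ℝ x u : ℝ) < T (i + 1)}
    have e1 : {x : EuclideanSpace ℝ (Fin d) | i + 1 ≤ N → (inner ℝ x u : ℝ) < T (i + 1)} ∩
        {x | (inner ℝ x u : ℝ) < T i} = {x | (inner ℝ x u : ℝ) < T i} := by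
      ext x
      simp only [Set.mem_inter_iff, Set.mem_ofPred_eq, and_iff_right_iff_imp]
      intro h h2
      exact h.trans (hm i h1 h2)
    have e2 : {x : EuclideanSpace ℝ (Fin d) | i + 1 ≤ N → (inner ℝ x u : ℝ) < T (i + 1)} ∩
        {x | T i < (inner ℝ x u : ℝ)} = slab u T N i := by
      ext x
      simp only [slab, Set.mem_inter_iff, Set.mem_ofPred_eq]
      tauto
    rw [e1, e2, hA] at hs
    have h3 := hT i h1 hi
    unfold Fq at h3
    rw [h3] at hs
    have : μ.real Set.univ / (N + 1) = ((i : ℝ) + 1) / (N + 1) * μ.real Set.univ -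
      (i : ℝ) / (N + 1) * μ.real Set.univ := by ring
    linarith

lemma slab_neg {d : ℕ} (u : EuclideanSpace ℝ (Fin d)) (T T' : ℕ → ℝ) (N : ℕ)
    (h : ∀ i, 1 ≤ i → i ≤ N → T' i = - T (N + 1 - i)) (i : ℕ) (hi : i ≤ N) :
    slab (-u) T' N i = slab u T N (N - i) := by
  ext x
  simp only [slab, Set.mem_ofPred_eq, inner_neg_right]
  constructor
  · rintro ⟨h1, h2⟩
    constructor
    · intro h3
      have := h2 (by omega)
      rw [h (i + 1) (by omega) (by omega), show N + 1 - (i + 1) = N - i by omega] at this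
      linarith
    · intro h3
      have := h1 (by omega)
      rw [h i (by omega) (by omega), show N + 1 - i = N - i + 1 by omega] at this
      linarith
  · rintro ⟨h1, h2⟩
    constructor
    · intro h3
      have := h2 (by omega)
      rw [h i (by omega) (by omega), show N + 1 - i = N - i + 1 by omega]
      linarith
    · intro h3
      have := h1 (by omega)
      rw [h (i + 1) (by omega) (by omega), show N + 1 - (i + 1) = N - i by omega]
      linarith

/-- Cut levels: the `i/(N+1)` quantiles in direction `u`. -/
noncomputable def TT {d : ℕ} (μ : Measure (EuclideanSpace ℝ (Fin d))) (N : ℕ)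
    (u : EuclideanSpace ℝ (Fin d)) (i : ℕ) : ℝ :=
  if 1 ≤ i ∧ i ≤ N then qt μ u ((i : ℝ) / (N + 1) * μ.real Set.univ) else 0

lemma frac_mem {N i : ℕ} {W : ℝ} (hW : 0 < W) (h1 : 1 ≤ i) (h2 : i ≤ N) :
    0 < (i : ℝ) / (N + 1) * W ∧ (i : ℝ) / (N + 1) * W < W := by
  have hN : (0 : ℝ) < N + 1 := by positivity
  have h1' : (1 : ℝ) ≤ i := by exact_mod_cast h1
  have h2' : (i : ℝ) ≤ N := by exact_mod_cast h2
  constructor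
  · positivity
  · have : (i : ℝ) / (N + 1) < 1 := by rw [div_lt_one hN]; linarith
    nlinarith

lemma TT_spec {d : ℕ} (μ : Measure (EuclideanSpace ℝ (Fin d))) [IsFiniteMeasure μ] (hac : μ ≪ volume)
    (hW : 0 < μ.real Set.univ) {u : EuclideanSpace ℝ (Fin d)} (hu : u ≠ 0) (N i : ℕ)
    (h1 : 1 ≤ i) (h2 : i ≤ N) : Fq μ u (TT μ N u i) = (i : ℝ) / (N + 1) * μ.real Set.univ := by
  obtain ⟨h3, h4⟩ := frac_mem hW h1 h2
  rw [TT, if_pos ⟨h1, h2⟩, qt_spec μ hac hu h3 h4]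

lemma TT_mono {d : ℕ} (μ : Measure (EuclideanSpace ℝ (Fin d))) [IsFiniteMeasure μ] (hac : μ ≪ volume)
    (hpos : ∀ U : Set (EuclideanSpace ℝ (Fin d)), IsOpen U → U.Nonempty → 0 < μ U)
    (hW : 0 < μ.real Set.univ) {u : EuclideanSpace ℝ (Fin d)} (hu : u ≠ 0) (N i j : ℕ)
    (h1 : 1 ≤ i) (hij : i < j) (h2 : j ≤ N) : TT μ N u i < TT μ N u j := by
  rw [← (Fq_strict μ hpos hu).lt_iff_lt, TT_spec μ hac hW hu N i h1 (by omega),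
    TT_spec μ hac hW hu N j (by omega) h2]
  have : (i : ℝ) < j := by exact_mod_cast hij
  gcongr

lemma TT_cont {d : ℕ} (μ : Measure (EuclideanSpace ℝ (Fin d))) [IsFiniteMeasure μ] (hac : μ ≪ volume)
    (hpos : ∀ U : Set (EuclideanSpace ℝ (Fin d)), IsOpen U → U.Nonempty → 0 < μ U)
    (hW : 0 < μ.real Set.univ) {u : EuclideanSpace ℝ (Fin d)} (hu : u ≠ 0) (N i : ℕ) :
    ContinuousAt (fun u => TT μ N u i) u := by
  by_cases h : 1 ≤ i ∧ i ≤ N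
  · obtain ⟨h3, h4⟩ := frac_mem hW h.1 h.2
    simp only [TT, if_pos h]
    exact qt_cont μ hac hpos hu h3 h4
  · simp only [TT, if_neg h]
    exact continuousAt_const

lemma TT_neg {d : ℕ} (μ : Measure (EuclideanSpace ℝ (Fin d))) [IsFiniteMeasure μ] (hac : μ ≪ volume)
    (hpos : ∀ U : Set (EuclideanSpace ℝ (Fin d)), IsOpen U → U.Nonempty → 0 < μ U)
    (hW : 0 < μ.real Set.univ) {u : EuclideanSpace ℝ (Fin d)} (hu : u ≠ 0) (N i : ℕ)
    (h1 : 1 ≤ i) (h2 : i ≤ N) : TT μ N (-u) i = - TT μ N u (N + 1 - i) := by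
  obtain ⟨h3, h4⟩ := frac_mem hW h1 h2
  rw [TT, TT, if_pos ⟨h1, h2⟩, if_pos ⟨by omega, by omega⟩, qt_neg μ hac hpos hu h3 h4]
  have hN : (0 : ℝ) < N + 1 := by positivity
  congr 2
  rw [Nat.cast_sub (by omega)]
  push_cast
  field_simp

/-- Unnormalized normal direction of the parallel cuts. -/
noncomputable def ZZ {m : ℕ} (p : Fin (m + m) → ℝ) : EuclideanSpace ℝ (Fin (m + 1)) :=
  WithLp.toLp 2 (Fin.cons (1 - ‖(fun i : Fin m => p (Fin.natAdd m i))‖) (fun i : Fin m => p (Fin.natAdd m i)))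

/-- Normal direction of the extra cut. -/
noncomputable def VV {m : ℕ} (p : Fin (m + m) → ℝ) : EuclideanSpace ℝ (Fin (m + 1)) :=
  WithLp.toLp 2 (Fin.cons 0 (fun i : Fin m => p (Fin.castAdd m i)))

/-- Level of the extra cut. -/
noncomputable def SS {m : ℕ} (p : Fin (m + m) → ℝ) : ℝ :=
  1 - ‖(fun i : Fin m => p (Fin.castAdd m i))‖

/-- Normal direction of the parallel cuts. -/
noncomputable def UU {m : ℕ} (p : Fin (m + m) → ℝ) : EuclideanSpace ℝ (Fin (m + 1)) :=
  ‖ZZ p‖⁻¹ • ZZ p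

lemma ZZ_ne {m : ℕ} (p : Fin (m + m) → ℝ) : ZZ p ≠ 0 := by
  intro h
  have h1 : ∀ j, (ZZ p) j = 0 := fun j => by rw [h]; rfl
  have h2 : (fun i : Fin m => p (Fin.natAdd m i)) = 0 := by
    funext i; simpa [ZZ] using h1 i.succ
  have h3 : 1 - ‖(fun i : Fin m => p (Fin.natAdd m i))‖ = 0 := h1 0
  rw [h2] at h3
  simp at h3

lemma VS_ne {m : ℕ} (p : Fin (m + m) → ℝ) : VV p ≠ 0 ∨ SS p ≠ 0 := by
  by_contra! h
  have h1 : ∀ j, (VV p) j = 0 := fun j => by rw [h.1]; rfl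
  have h2 : (fun i : Fin m => p (Fin.castAdd m i)) = 0 := by
    funext i; simpa [VV] using h1 i.succ
  have h3 := h.2
  simp [SS, h2] at h3

lemma UU_norm {m : ℕ} (p : Fin (m + m) → ℝ) : ‖UU p‖ = 1 := by
  rw [UU, norm_smul, norm_inv, norm_norm, inv_mul_cancel₀ (norm_ne_zero_iff.2 (ZZ_ne p))]

lemma UU_ne {m : ℕ} (p : Fin (m + m) → ℝ) : UU p ≠ 0 := by
  intro h; have := UU_norm p; rw [h] at this; simp at this

lemma cons_cont {m : ℕ} (g : (Fin (m + m) → ℝ) → ℝ) (h : (Fin (m + m) → ℝ) → Fin m → ℝ)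
    (hg : Continuous g) (hh : Continuous h) :
    Continuous (fun p => (WithLp.toLp 2 (Fin.cons (g p) (h p)) : EuclideanSpace ℝ (Fin (m + 1)))) := by
  refine (PiLp.continuous_toLp 2 _).comp (continuous_pi fun j => ?_)
  refine Fin.cases ?_ (fun i => ?_) j
  · simpa using hg
  · simpa [Function.comp_def] using (continuous_apply i).comp hh

lemma ZZ_cont {m : ℕ} : Continuous (ZZ (m := m)) := by
  apply cons_cont <;> fun_prop

lemma VV_cont {m : ℕ} : Continuous (VV (m := m)) := by
  apply cons_cont <;> fun_prop

lemma SS_cont {m : ℕ} : Continuous (SS (m := m)) := by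
  unfold SS; fun_prop

lemma UU_cont {m : ℕ} : Continuous (UU (m := m)) := by
  have := ZZ_cont (m := m)
  exact (this.norm.inv₀ (fun p => norm_ne_zero_iff.2 (ZZ_ne p))).smul this

lemma blk_cast (m : ℕ) (i : Fin m) : blk m (Fin.castAdd m i) = true := by simp [blk]

lemma blk_nat (m : ℕ) (i : Fin m) : blk m (Fin.natAdd m i) = false := by simp [blk]

lemma norm_one {m : ℕ} (q : Fin m → ℝ) (h : ∀ i, |q i| ≤ 1) (h1 : ∃ i, |q i| = 1) : ‖q‖ = 1 := by
  apply le_antisymm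
  · exact (pi_norm_le_iff_of_nonneg zero_le_one).2 h
  · obtain ⟨i, hi⟩ := h1
    rw [← hi]; exact norm_le_pi_norm q i

lemma bd_true {m : ℕ} (p : Fin (m + m) → ℝ) (h : ∀ i, |p i| ≤ 1)
    (h1 : ∃ i, blk m i = true ∧ |p i| = 1) :
    UU (refl (blk m) true p) = UU p ∧ VV (refl (blk m) true p) = - VV p ∧
      SS (refl (blk m) true p) = 0 ∧ SS p = 0 := by
  have ea : (fun i : Fin m => refl (blk m) true p (Fin.natAdd m i)) = fun i => p (Fin.natAdd m i) := by
    funext i; simp only [refl, blk_nat, Pi.neg_apply]; simp only [reduceIte, Bool.false_eq_true]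
  have eb : (fun i : Fin m => refl (blk m) true p (Fin.castAdd m i)) = - fun i => p (Fin.castAdd m i) := by
    funext i; simp [refl, blk_cast]
  have hn : ‖(fun i : Fin m => p (Fin.castAdd m i))‖ = 1 := by
    apply norm_one _ (fun i => h _)
    obtain ⟨i, hi, hp⟩ := h1
    have hi' : (i : ℕ) < m := by simpa [blk] using hi
    exact ⟨⟨i, hi'⟩, hp⟩
  refine ⟨?_, ?_, ?_, ?_⟩
  · simp only [UU, ZZ, ea]
  · ext j
    simp only [VV, eb]
    refine Fin.cases ?_ (fun i => ?_) j <;> simp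
  · rw [SS, eb, norm_neg, hn, sub_self]
  · rw [SS, hn, sub_self]

lemma bd_false {m : ℕ} (p : Fin (m + m) → ℝ) (h : ∀ i, |p i| ≤ 1)
    (h1 : ∃ i, blk m i = false ∧ |p i| = 1) :
    UU (refl (blk m) false p) = - UU p ∧ VV (refl (blk m) false p) = VV p ∧
      SS (refl (blk m) false p) = SS p := by
  have ea : (fun i : Fin m => refl (blk m) false p (Fin.natAdd m i)) = - fun i => p (Fin.natAdd m i) := by
    funext i; simp only [refl, blk_nat, Pi.neg_apply]; simp only [reduceIte, Bool.false_eq_true]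
  have eb : (fun i : Fin m => refl (blk m) false p (Fin.castAdd m i)) = fun i => p (Fin.castAdd m i) := by
    funext i; simp [refl, blk_cast]
  have hn : ‖(fun i : Fin m => p (Fin.natAdd m i))‖ = 1 := by
    apply norm_one _ (fun i => h _)
    obtain ⟨i, hi, hp⟩ := h1
    have hi' : m ≤ (i : ℕ) := by simpa [blk] using hi
    refine ⟨⟨i - m, by omega⟩, ?_⟩
    rw [← hp]; congr 2; ext; simp; omega
  have hZ : ZZ (refl (blk m) false p) = - ZZ p := by
    ext j
    simp only [ZZ, ea, norm_neg, hn, sub_self]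
    refine Fin.cases ?_ (fun i => ?_) j <;> simp
  refine ⟨?_, ?_, ?_⟩
  · simp only [UU, hZ, norm_neg, smul_neg]
  · simp only [VV, eb]
  · simp only [SS, eb]

/-- Difference of the two halves of the `i`-th slab. -/
noncomputable def cc {m : ℕ} (μ : Measure (EuclideanSpace ℝ (Fin (m + 1)))) (i : ℕ)
    (p : Fin (m + m) → ℝ) : ℝ :=
  μ.real (slab (UU p) (TT μ (m + m - 1) (UU p)) (m + m - 1) i ∩ {y | (inner ℝ y (VV p) : ℝ) < SS p}) -
  μ.real (slab (UU p) (TT μ (m + m - 1) (UU p)) (m + m - 1) i ∩ {y | SS p < (inner ℝ y (VV p) : ℝ)})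

theorem cc_zero {m : ℕ} (hm : 1 ≤ m) (μ : Measure (EuclideanSpace ℝ (Fin (m + 1)))) [IsFiniteMeasure μ]
    (hac : μ ≪ volume)
    (hpos : ∀ U : Set (EuclideanSpace ℝ (Fin (m + 1))), IsOpen U → U.Nonempty → 0 < μ U)
    (hW : 0 < μ.real Set.univ) :
    ∃ p : Fin (m + m) → ℝ, ∀ i ≤ m + m - 1, cc μ i p = 0 := by
  have hcont : ∀ i, Continuous (cc μ i : (Fin (m + m) → ℝ) → ℝ) := by
    intro i
    rw [continuous_iff_continuousAt]; intro p
    have := box_cont μ hac UU VV SS (fun p => TT μ (m + m - 1) (UU p)) p UU_cont.continuousAt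
      VV_cont.continuousAt SS_cont.continuousAt
      (fun i => (TT_cont μ hac hpos hW (UU_ne p) _ i).comp (f := UU) UU_cont.continuousAt)
      (UU_ne p) (VS_ne p) (m + m - 1) i
    exact this.1.sub this.2
  have hB : ∀ i, ∀ p : Fin (m + m) → ℝ, (∀ i, |p i| ≤ 1) → (∃ i, blk m i = true ∧ |p i| = 1) →
      cc μ i (refl (blk m) true p) = - cc μ i p := by
    intro i p h h1
    obtain ⟨e1, e2, e3, e4⟩ := bd_true p h h1
    simp only [cc, e1, e2, e3, e4, inner_neg_right, neg_lt_zero, neg_pos]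
    ring
  have hA : ∀ i ≤ m + m - 1, ∀ p : Fin (m + m) → ℝ, (∀ i, |p i| ≤ 1) →
      (∃ i, blk m i = false ∧ |p i| = 1) →
      cc μ i (refl (blk m) false p) = cc μ (m + m - 1 - i) p := by
    intro i hi p h h1
    obtain ⟨e1, e2, e3⟩ := bd_false p h h1
    have e4 := slab_neg (UU p) (TT μ (m + m - 1) (UU p)) (TT μ (m + m - 1) (-UU p)) (m + m - 1)
      (TT_neg μ hac hpos hW (UU_ne p) _) i hi
    simp only [cc, e1, e2, e3, e4]
  obtain ⟨p, hp⟩ := zero_exists (m := m)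
    (fun k p => if k < m then cc μ k p + cc μ (m + m - 1 - k) p else cc μ k p - cc μ (m + m - 1 - k) p)
    (by
      intro k _
      by_cases h : k < m
      · simp only [if_pos h]; exact (hcont _).add (hcont _)
      · simp only [if_neg h]; exact (hcont _).sub (hcont _))
    (by
      intro k _ p h h1
      simp only [hB _ p h h1]
      split_ifs <;> ring)
    (by
      intro k hk p h h1
      simp only [if_pos hk]
      rw [hA k (by omega) p h h1, hA (m + m - 1 - k) (by omega) p h h1,
        show m + m - 1 - (m + m - 1 - k) = k by omega]
      ring)
    (by
      intro k hk hk2 p h h1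
      simp only [if_neg (not_lt.2 hk)]
      rw [hA k (by omega) p h h1, hA (m + m - 1 - k) (by omega) p h h1,
        show m + m - 1 - (m + m - 1 - k) = k by omega]
      ring)
  refine ⟨p, fun i hi => ?_⟩
  have h1 := hp i (by omega)
  have h2 := hp (m + m - 1 - i) (by omega)
  simp only [show m + m - 1 - (m + m - 1 - i) = i by omega] at h1 h2
  by_cases h : i < m
  · rw [if_pos h] at h1
    rw [if_neg (by omega)] at h2
    linarith
  · rw [if_neg h] at h1
    rw [if_pos (by omega)] at h2
    linarith

end Equi

open Equi in
/-- Every mass distribution in `ℝ^d` (`d ≥ 2`) admits an equipartition into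
`4d - 4` boxes by a collection of `2d - 3` parallel hyperplanes and one
additional non-parallel hyperplane. -/
theorem equipartition_parallel_2d_sub_3 (d : ℕ) (hd : 2 ≤ d)
    (μ : Measure (EuclideanSpace ℝ (Fin d)))
    (f : EuclideanSpace ℝ (Fin d) → ℝ) (hf : Integrable f)
    (hμ : ∀ A : Set (EuclideanSpace ℝ (Fin d)), MeasurableSet A →
      μ A = ENNReal.ofReal (∫ x in A, f x))
    (hpos : ∀ U : Set (EuclideanSpace ℝ (Fin d)), IsOpen U → U.Nonempty → 0 < μ U) :
    ∃ (u v : EuclideanSpace ℝ (Fin d)) (t : ℕ → ℝ) (s : ℝ),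
      ‖u‖ = 1 ∧ ‖v‖ = 1 ∧ v ≠ u ∧ v ≠ -u ∧
      StrictMonoOn t (Set.Icc 1 (2 * d - 3)) ∧
      ∀ i ≤ 2 * d - 3, ∀ b : Bool,
        μ (slab u t (2 * d - 3) i ∩ halfSp v s b) =
          μ Set.univ / ((4 * d - 4 : ℕ) : ENNReal) := by
  obtain ⟨m, rfl⟩ : ∃ m, d = m + 1 := ⟨d - 1, by omega⟩
  have hm : 1 ≤ m := by omega
  rw [show 2 * (m + 1) - 3 = m + m - 1 by omega, show 4 * (m + 1) - 4 = 4 * m by omega]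
  haveI : IsFiniteMeasure μ := ⟨by rw [hμ _ MeasurableSet.univ]; exact ENNReal.ofReal_lt_top⟩
  have hac : μ ≪ volume := by
    refine Measure.AbsolutelyContinuous.mk fun A hA h0 => ?_
    rw [hμ A hA, setIntegral_measure_zero f h0, ENNReal.ofReal_zero]
  have hW : 0 < μ.real Set.univ :=
    ENNReal.toReal_pos (hpos _ isOpen_univ Set.univ_nonempty).ne' (measure_ne_top μ _)
  obtain ⟨p, hp⟩ := cc_zero hm μ hac hpos hW
  have hu1 := UU_norm p
  have hu0 := UU_ne p
  have hVS := VS_ne p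
  have hmono := TT_mono μ hac hpos hW hu0 (m + m - 1)
  have hsl := slab_meas μ hac hu0 (TT μ (m + m - 1) (UU p)) (m + m - 1)
    (TT_spec μ hac hW hu0 (m + m - 1)) (fun i h1 h2 => hmono i (i + 1) h1 (by omega) h2)
  have hN : ((m + m - 1 : ℕ) : ℝ) + 1 = 2 * m := by
    rw [Nat.cast_sub (by omega)]; push_cast; ring
  rw [hN] at hsl
  have hm0 : (0 : ℝ) < m := by exact_mod_cast hm
  simp only [cc] at hp
  set u := UU p
  set V := VV p
  set S := SS p
  set T := TT μ (m + m - 1) u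
  have hq : 0 < μ.real Set.univ / (4 * m) := by positivity
  have half : ∀ i ≤ m + m - 1,
      μ.real (slab u T (m + m - 1) i ∩ {y | (inner ℝ y V : ℝ) < S}) = μ.real Set.univ / (4 * m) ∧
      μ.real (slab u T (m + m - 1) i ∩ {y | S < (inner ℝ y V : ℝ)}) = μ.real Set.univ / (4 * m) := by
    intro i hi
    have h1 := hp i hi
    have h2 := real_split μ hac V S hVS (slab u T (m + m - 1) i)
    rw [hsl i hi] at h2
    have h3 : μ.real Set.univ / (2 * m) = 2 * (μ.real Set.univ / (4 * m)) := by
      field_simp; norm_num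
    constructor <;> linarith
  have ne : ∀ A : Set (EuclideanSpace ℝ (Fin (m + 1))), μ.real A = μ.real Set.univ / (4 * m) → A.Nonempty := by
    intro A hA
    rw [Set.nonempty_iff_ne_empty]
    rintro rfl
    rw [measureReal_empty] at hA
    linarith
  have hV : V ≠ 0 := by
    intro h
    obtain ⟨x, hx⟩ := ne _ (half 0 (by omega)).1
    obtain ⟨y, hy⟩ := ne _ (half 0 (by omega)).2
    have hx2 : (inner ℝ x V : ℝ) < S := hx.2
    have hy2 : S < (inner ℝ y V : ℝ) := hy.2
    rw [h, inner_zero_right] at hx2 hy2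
    linarith
  have hVn : 0 < ‖V‖ := norm_pos_iff.2 hV
  -- the extra cut is not parallel to the others
  have key : ∀ c : ℝ, V ≠ c • u := by
    intro c hc
    have hin : ∀ x, (inner ℝ x V : ℝ) = c * inner ℝ x u := fun x => by rw [hc, real_inner_smul_right]
    obtain ⟨x, hx1, hx2⟩ := ne _ (half 0 (by omega)).1
    obtain ⟨y, hy1, hy2⟩ := ne _ (half 0 (by omega)).2
    obtain ⟨x', hx1', hx2'⟩ := ne _ (half 1 (by omega)).1
    obtain ⟨y', hy1', hy2'⟩ := ne _ (half 1 (by omega)).2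
    have a1 := hx1.2 (by omega)
    have a2 := hy1.2 (by omega)
    have a3 := hx1'.1 le_rfl
    have a4 := hy1'.1 le_rfl
    rw [zero_add] at a1 a2
    change (inner ℝ x V : ℝ) < S at hx2
    change S < (inner ℝ y V : ℝ) at hy2
    change (inner ℝ x' V : ℝ) < S at hx2'
    change S < (inner ℝ y' V : ℝ) at hy2'
    rw [hin] at hx2 hy2 hx2' hy2'
    rcases le_total 0 c with h | h
    · nlinarith
    · nlinarith
  refine ⟨u, ‖V‖⁻¹ • V, T, ‖V‖⁻¹ * S, hu1, ?_, ?_, ?_, ?_, ?_⟩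
  · rw [norm_smul, norm_inv, norm_norm, inv_mul_cancel₀ hVn.ne']
  · intro h
    apply key ‖V‖
    rw [← h, smul_smul, mul_inv_cancel₀ hVn.ne', one_smul]
  · intro h
    apply key (-‖V‖)
    rw [neg_smul, ← smul_neg, ← h, smul_smul, mul_inv_cancel₀ hVn.ne', one_smul]
  · intro i hi j hj hij
    exact hmono i j hi.1 hij hj.2
  · intro i hi b
    have hfin : ∀ A : Set (EuclideanSpace ℝ (Fin (m + 1))), μ.real A = μ.real Set.univ / (4 * m) →
        μ A = μ Set.univ / ((4 * m : ℕ) : ENNReal) := by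
      intro A hA
      rw [← ENNReal.toReal_eq_toReal_iff' (measure_ne_top μ _), ENNReal.toReal_div,
        ENNReal.toReal_natCast]
      · push_cast; exact hA
      · exact ENNReal.div_ne_top (measure_ne_top μ _) (by simp; omega)
    have hin : ∀ x, (inner ℝ x (‖V‖⁻¹ • V) : ℝ) = ‖V‖⁻¹ * inner ℝ x V := fun x => by
      rw [real_inner_smul_right]
    apply hfin
    have hinv : 0 < ‖V‖⁻¹ := inv_pos.2 hVn
    cases b
    · rw [← (half i hi).2]
      simp only [halfSp, hin, mul_lt_mul_iff_right₀ hinv, Bool.false_eq_true, if_false]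
    · rw [← (half i hi).1]
      simp only [halfSp, hin, mul_lt_mul_iff_right₀ hinv, if_true]
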